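/- arXiv:2107.00787 — 3 statements merged into one kernel-verified Lean document; each statement's English description precedes it below -/
import Mathlib

section
/- For every nonnegative integer n, 6 · N*(1,5; 8n+16) = Ñ(1,5; 8n+16). -/
/-- `N a b n` is the number of tuples `(x₁,…,x_a,y₁,…,y_b) ∈ ℤ^{a+b}` with
`n = x₁² + ⋯ + x_a² + 3y₁² + ⋯ + 3y_b²`. -/
noncomputable def N (a b : ℕ) (n : ℤ) : ℕ :=
  Set.ncard {p : (Fin a → ℤ) × (Fin b → ℤ) |
    n = ∑ i, (p.1 i) ^ 2 + 3 * ∑ j, (p.2 j) ^ 2}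

/-- `Nstar a b n` is the number of such tuples with all coordinates odd. -/
noncomputable def Nstar (a b : ℕ) (n : ℤ) : ℕ :=
  Set.ncard {p : (Fin a → ℤ) × (Fin b → ℤ) |
    (∀ i, Odd (p.1 i)) ∧ (∀ j, Odd (p.2 j)) ∧
    n = ∑ i, (p.1 i) ^ 2 + 3 * ∑ j, (p.2 j) ^ 2}

/-- `Ntilde a b n = N a b n - N a b (n/4)`, where the second term is `0` when `4 ∤ n`. -/
noncomputable def Ntilde (a b : ℕ) (n : ℤ) : ℤ :=
  (N a b n : ℤ) - (if (4 : ℤ) ∣ n then (N a b (n / 4) : ℤ) else 0)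

open Finset in
/-- Two finsets exchanged by an involution have the same cardinality. -/
lemma card_eq_of_involOn {α : Type*} {s t : Finset α} (f : α → α)
    (hst : ∀ a ∈ s, f a ∈ t) (hts : ∀ a ∈ t, f a ∈ s)
    (hs : ∀ a ∈ s, f (f a) = a) (ht : ∀ a ∈ t, f (f a) = a) : #s = #t :=
  Finset.card_nbij' f f hst hts hs ht

/-- The representations of `m` by `x² + 3(y₀² + ⋯ + y₄²)`. -/
def reps (m : ℤ) : Set ((Fin 1 → ℤ) × (Fin 5 → ℤ)) :=
  {p | m = ∑ i, (p.1 i) ^ 2 + 3 * ∑ j, (p.2 j) ^ 2}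

lemma mem_reps {m : ℤ} {p : (Fin 1 → ℤ) × (Fin 5 → ℤ)} :
    p ∈ reps m ↔ m = p.1 0 ^ 2 + 3 * ∑ j, (p.2 j) ^ 2 := by
  simp [reps]

lemma mem_reps_succAbove {m : ℤ} {p : (Fin 1 → ℤ) × (Fin 5 → ℤ)} (i : Fin 5) :
    p ∈ reps m ↔
      m = p.1 0 ^ 2 + 3 * (p.2 i ^ 2 + ∑ j : Fin 4, p.2 (i.succAbove j) ^ 2) := by
  rw [mem_reps, Fin.sum_univ_succAbove _ i]

lemma finite_reps (m : ℤ) : (reps m).Finite := by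
  refine Set.Finite.subset (Set.Finite.prod
    (Set.Finite.pi' (t := fun _ : Fin 1 => Set.Icc (-m) m) fun _ => Set.finite_Icc _ _)
    (Set.Finite.pi' (t := fun _ : Fin 5 => Set.Icc (-m) m) fun _ => Set.finite_Icc _ _)) ?_
  have key : ∀ z : ℤ, z ^ 2 ≤ m → z ∈ Set.Icc (-m) m := fun z hz =>
    ⟨by linarith [Int.le_self_sq (-z), neg_sq z], (Int.le_self_sq z).trans hz⟩
  intro p hp
  refine ⟨fun i => key _ ?_, fun i => key _ ?_⟩
  · rw [mem_reps] at hp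
    have : 0 ≤ ∑ j, (p.2 j) ^ 2 := Finset.sum_nonneg fun _ _ => sq_nonneg _
    rw [Subsingleton.elim i 0]
    lia
  · rw [mem_reps_succAbove i] at hp
    have : 0 ≤ ∑ j : Fin 4, p.2 (i.succAbove j) ^ 2 := Finset.sum_nonneg fun _ _ => sq_nonneg _
    have := sq_nonneg (p.1 0)
    have := sq_nonneg (p.2 i)
    lia

/-- The finset of representations of `m` by `x² + 3(y₀² + ⋯ + y₄²)`. -/
noncomputable def repsFinset (m : ℤ) : Finset ((Fin 1 → ℤ) × (Fin 5 → ℤ)) :=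
  (finite_reps m).toFinset

lemma mem_repsFinset {m : ℤ} {p : (Fin 1 → ℤ) × (Fin 5 → ℤ)} (i : Fin 5) :
    p ∈ repsFinset m ↔
      m = p.1 0 ^ 2 + 3 * (p.2 i ^ 2 + ∑ j : Fin 4, p.2 (i.succAbove j) ^ 2) := by
  rw [repsFinset, Set.Finite.mem_toFinset, mem_reps_succAbove i]

lemma mem_repsFinset_iff {m : ℤ} {p : (Fin 1 → ℤ) × (Fin 5 → ℤ)} :
    p ∈ repsFinset m ↔ p ∈ reps m := by
  rw [repsFinset, Set.Finite.mem_toFinset]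

/-- All coordinates are odd. -/
def AllOdd (p : (Fin 1 → ℤ) × (Fin 5 → ℤ)) : Prop :=
  Odd (p.1 0) ∧ ∀ j, Odd (p.2 j)

/-- All coordinates are even. -/
def AllEven (p : (Fin 1 → ℤ) × (Fin 5 → ℤ)) : Prop :=
  Even (p.1 0) ∧ ∀ j, Even (p.2 j)

/-- Exactly `x` and `yᵢ` are odd. -/
def OddPair (i : Fin 5) (p : (Fin 1 → ℤ) × (Fin 5 → ℤ)) : Prop :=
  Odd (p.1 0) ∧ Odd (p.2 i) ∧ ∀ j : Fin 4, Even (p.2 (i.succAbove j))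

/-- Exactly `x` and `yᵢ` are even. -/
def EvenPair (i : Fin 5) (p : (Fin 1 → ℤ) × (Fin 5 → ℤ)) : Prop :=
  Even (p.1 0) ∧ Even (p.2 i) ∧ ∀ j : Fin 4, Odd (p.2 (i.succAbove j))

lemma allOdd_iff (i : Fin 5) {p : (Fin 1 → ℤ) × (Fin 5 → ℤ)} :
    AllOdd p ↔ Odd (p.1 0) ∧ Odd (p.2 i) ∧ ∀ j : Fin 4, Odd (p.2 (i.succAbove j)) := by
  rw [AllOdd, Fin.forall_iff_succAbove i]

/-- The isometry `(x, y) ↦ ((x + 3y)/2, (x - y)/2)` of `x² + 3y²`. -/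
def pairReflection (i : Fin 5) (p : (Fin 1 → ℤ) × (Fin 5 → ℤ)) :
    (Fin 1 → ℤ) × (Fin 5 → ℤ) :=
  (fun _ => (p.1 0 + 3 * p.2 i) / 2,
    i.insertNth ((p.1 0 - p.2 i) / 2) fun j : Fin 4 => p.2 (i.succAbove j))

/-- The reflection of the four coordinates other than `yᵢ` in the hyperplane
orthogonal to `(1, 1, 1, 1)`. -/
def quadReflection (i : Fin 5) (p : (Fin 1 → ℤ) × (Fin 5 → ℤ)) :
    (Fin 1 → ℤ) × (Fin 5 → ℤ) :=
  (p.1, i.insertNth (p.2 i) fun j : Fin 4 =>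
    p.2 (i.succAbove j) - (∑ k : Fin 4, p.2 (i.succAbove k)) / 2)

lemma rep_ext (i : Fin 5) {p q : (Fin 1 → ℤ) × (Fin 5 → ℤ)} (h : p.1 0 = q.1 0)
    (hi : p.2 i = q.2 i) (hj : ∀ j : Fin 4, p.2 (i.succAbove j) = q.2 (i.succAbove j)) :
    p = q := by
  refine Prod.ext (funext fun k => ?_) (funext ((Fin.forall_iff_succAbove i).2 ⟨hi, hj⟩))
  rwa [Subsingleton.elim k 0]

lemma pairReflection_pairReflection (i : Fin 5) {p : (Fin 1 → ℤ) × (Fin 5 → ℤ)}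
    (h : Even (p.1 0 - p.2 i)) : pairReflection i (pairReflection i p) = p := by
  obtain ⟨k, hk⟩ := h
  apply rep_ext i <;> simp [pairReflection] <;> lia

lemma quadReflection_quadReflection (i : Fin 5) {p : (Fin 1 → ℤ) × (Fin 5 → ℤ)}
    (h : Even (∑ k : Fin 4, p.2 (i.succAbove k))) :
    quadReflection i (quadReflection i p) = p := by
  obtain ⟨k, hk⟩ := h
  rw [Fin.sum_univ_four] at hk
  apply rep_ext i <;> simp [quadReflection, Fin.sum_univ_four]
  lia

lemma pairReflection_mem (i : Fin 5) {m : ℤ} {p : (Fin 1 → ℤ) × (Fin 5 → ℤ)}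
    (h : Even (p.1 0 - p.2 i)) (hp : p ∈ repsFinset m) :
    pairReflection i p ∈ repsFinset m := by
  rw [mem_repsFinset i] at hp ⊢
  obtain ⟨k, hk⟩ := h
  have hx : p.1 0 = p.2 i + 2 * k := by lia
  have h1 : (p.1 0 + 3 * p.2 i) / 2 = 2 * p.2 i + k := by lia
  have h2 : (p.1 0 - p.2 i) / 2 = k := by lia
  simp only [pairReflection, Fin.insertNth_apply_same, Fin.insertNth_apply_succAbove, h1, h2]
  rw [hp, hx]
  ring

lemma quadReflection_mem (i : Fin 5) {m : ℤ} {p : (Fin 1 → ℤ) × (Fin 5 → ℤ)}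
    (h : Even (∑ k : Fin 4, p.2 (i.succAbove k))) (hp : p ∈ repsFinset m) :
    quadReflection i p ∈ repsFinset m := by
  rw [mem_repsFinset i] at hp ⊢
  obtain ⟨k, hk⟩ := h
  have h1 : (∑ k : Fin 4, p.2 (i.succAbove k)) / 2 = k := by lia
  simp only [quadReflection, Fin.insertNth_apply_same, Fin.insertNth_apply_succAbove, h1]
  rw [hp]
  rw [Fin.sum_univ_four] at hk
  simp only [Fin.sum_univ_four]
  linear_combination (6 * k) * hk

lemma sq_emod_eight_of_odd {z : ℤ} (h : Odd z) : z ^ 2 % 8 = 1 := by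
  have := Int.eight_dvd_sq_sub_one_of_odd h
  lia

lemma sq_emod_eight_of_even {z : ℤ} (h : Even z) : z ^ 2 % 8 = 2 * (z % 4) := by
  obtain ⟨k, rfl⟩ := h
  rcases Int.even_or_odd' k with ⟨l, rfl | rfl⟩ <;> ring_nf <;> omega

open Finset Classical in
lemma card_allOdd_eq_two_mul_card_evenPair (i : Fin 5) {m : ℤ} (hm : 8 ∣ m) :
    #{p ∈ repsFinset m | AllOdd p} = 2 * #{p ∈ repsFinset m | EvenPair i p} := by
  have hsplit := card_filter_add_card_filter_not (s := {p ∈ repsFinset m | AllOdd p})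
    (fun p => 4 ∣ p.1 0 - p.2 i)
  have hneg : #{p ∈ {p ∈ repsFinset m | AllOdd p} | 4 ∣ p.1 0 - p.2 i} =
      #{p ∈ {p ∈ repsFinset m | AllOdd p} | ¬ 4 ∣ p.1 0 - p.2 i} := by
    apply card_eq_of_involOn fun p => (-p.1, p.2)
    · simp only [mem_filter, mem_repsFinset i, allOdd_iff i, Pi.neg_apply, neg_sq, odd_neg]
      rintro p ⟨⟨h, ⟨a, ha⟩, ⟨b, hb⟩, hc⟩, hd⟩
      exact ⟨⟨h, ⟨a, ha⟩, ⟨b, hb⟩, hc⟩, by lia⟩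
    · simp only [mem_filter, mem_repsFinset i, allOdd_iff i, Pi.neg_apply, neg_sq, odd_neg]
      rintro p ⟨⟨h, ⟨a, ha⟩, ⟨b, hb⟩, hc⟩, hd⟩
      exact ⟨⟨h, ⟨a, ha⟩, ⟨b, hb⟩, hc⟩, by lia⟩
    · simp
    · simp
  have hrefl : #{p ∈ {p ∈ repsFinset m | AllOdd p} | 4 ∣ p.1 0 - p.2 i} =
      #{p ∈ repsFinset m | EvenPair i p} := by
    apply card_eq_of_involOn (pairReflection i)
    · simp only [mem_filter, allOdd_iff i]
      rintro p ⟨⟨h, ha, hb, hc⟩, hd⟩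
      refine ⟨pairReflection_mem i (ha.sub_odd hb) h, ?_⟩
      simp only [EvenPair, pairReflection, Fin.insertNth_apply_same,
        Fin.insertNth_apply_succAbove]
      rw [Int.even_iff, Int.even_iff]
      exact ⟨by lia, by lia, hc⟩
    · simp only [mem_filter, allOdd_iff i]
      rintro p ⟨h, ha, hb, hc⟩
      refine ⟨⟨pairReflection_mem i (ha.sub hb) h, ?_⟩, ?_⟩
      all_goals
        rw [mem_repsFinset i, Fin.sum_univ_four] at h
        have h0 := sq_emod_eight_of_odd (hc 0)
        have h1 := sq_emod_eight_of_odd (hc 1)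
        have h2 := sq_emod_eight_of_odd (hc 2)
        have h3 := sq_emod_eight_of_odd (hc 3)
        obtain ⟨a, ha⟩ := even_iff_two_dvd.1 ha
        obtain ⟨b, hb⟩ := even_iff_two_dvd.1 hb
        have hab : (a + b) % 2 = 1 := by
          have e : p.1 0 ^ 2 + 3 * p.2 i ^ 2 = 4 * (a ^ 2 + 3 * b ^ 2) := by rw [ha, hb]; ring
          have h4 : (a ^ 2 + 3 * b ^ 2) % 2 = 1 := by omega
          rw [← Int.odd_iff] at h4 ⊢
          simpa [parity_simps, show ¬ Even (3 : ℤ) by decide] using h4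
        simp only [pairReflection, Fin.insertNth_apply_same, Fin.insertNth_apply_succAbove]
      · rw [Int.odd_iff, Int.odd_iff]
        exact ⟨by lia, by lia, hc⟩
      · lia
    · simp only [mem_filter, allOdd_iff i]
      rintro p ⟨⟨h, ha, hb, hc⟩, hd⟩
      exact pairReflection_pairReflection i (ha.sub_odd hb)
    · simp only [mem_filter]
      rintro p ⟨h, ha, hb, hc⟩
      exact pairReflection_pairReflection i (ha.sub hb)
  lia

open Finset Classical in
lemma card_allOdd_eq_two_mul_card_oddPair (i : Fin 5) {m : ℤ} (hm : 8 ∣ m) :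
    #{p ∈ repsFinset m | AllOdd p} = 2 * #{p ∈ repsFinset m | OddPair i p} := by
  have hsum_odd {f : Fin 4 → ℤ} (hf : ∀ j, Odd (f j)) : Even (∑ j, f j) := by
    rw [Fin.sum_univ_four]
    exact (((hf 0).add_odd (hf 1)).add_odd (hf 2)).add_odd (hf 3)
  have hsum_even {f : Fin 4 → ℤ} (hf : ∀ j, Even (f j)) : Even (∑ j, f j) := by
    rw [Fin.sum_univ_four]
    exact (((hf 0).add (hf 1)).add (hf 2)).add (hf 3)
  have hsplit := card_filter_add_card_filter_not (s := {p ∈ repsFinset m | AllOdd p})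
    (fun p => 4 ∣ ∑ k : Fin 4, p.2 (i.succAbove k))
  have hneg : #{p ∈ {p ∈ repsFinset m | AllOdd p} | 4 ∣ ∑ k : Fin 4, p.2 (i.succAbove k)} =
      #{p ∈ {p ∈ repsFinset m | AllOdd p} | ¬ 4 ∣ ∑ k : Fin 4, p.2 (i.succAbove k)} := by
    apply card_eq_of_involOn fun p => (p.1, i.insertNth (p.2 i) fun j : Fin 4 =>
      if j = 0 then -p.2 (i.succAbove j) else p.2 (i.succAbove j))
    · simp only [mem_filter, mem_repsFinset i, allOdd_iff i, Fin.sum_univ_four,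
        Fin.forall_fin_succ, Fin.insertNth_apply_same, Fin.insertNth_apply_succAbove]
      rintro p ⟨⟨h, ha, hb, ⟨c, hc⟩, ⟨d, hd⟩, ⟨e, he⟩, ⟨f, hf⟩, -⟩, hs⟩
      refine ⟨⟨by simpa using h, ha, hb, ⟨-c - 1, ?_⟩, ⟨d, ?_⟩, ⟨e, ?_⟩, ⟨f, ?_⟩, by simp⟩, ?_⟩ <;>
        simp at * <;> lia
    · simp only [mem_filter, mem_repsFinset i, allOdd_iff i, Fin.sum_univ_four,
        Fin.forall_fin_succ, Fin.insertNth_apply_same, Fin.insertNth_apply_succAbove]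
      rintro p ⟨⟨h, ha, hb, ⟨c, hc⟩, ⟨d, hd⟩, ⟨e, he⟩, ⟨f, hf⟩, -⟩, hs⟩
      refine ⟨⟨by simpa using h, ha, hb, ⟨-c - 1, ?_⟩, ⟨d, ?_⟩, ⟨e, ?_⟩, ⟨f, ?_⟩, by simp⟩, ?_⟩ <;>
        simp at * <;> lia
    · rintro p -
      apply rep_ext i <;> simp +contextual
    · rintro p -
      apply rep_ext i <;> simp +contextual
  have hrefl : #{p ∈ {p ∈ repsFinset m | AllOdd p} | ¬ 4 ∣ ∑ k : Fin 4, p.2 (i.succAbove k)} =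
      #{p ∈ repsFinset m | OddPair i p} := by
    apply card_eq_of_involOn (quadReflection i)
    · simp only [mem_filter, allOdd_iff i]
      rintro p ⟨⟨h, ha, hb, hc⟩, hd⟩
      have he := hsum_odd hc
      refine ⟨quadReflection_mem i he h, ?_⟩
      simp only [OddPair, quadReflection, Fin.insertNth_apply_same,
        Fin.insertNth_apply_succAbove]
      refine ⟨ha, hb, fun j => ?_⟩
      have := hc j
      rw [Int.odd_iff] at this
      rw [Int.even_iff] at he ⊢
      lia
    · simp only [mem_filter, allOdd_iff i]
      rintro p ⟨h, ha, hb, hc⟩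
      have he := hsum_even hc
      have hmem := quadReflection_mem i he h
      have hhalf : (∑ k : Fin 4, p.2 (i.succAbove k)) % 4 = 2 := by
        rw [mem_repsFinset i, Fin.sum_univ_four] at h
        rw [Fin.sum_univ_four]
        have h0 := sq_emod_eight_of_odd ha
        have h1 := sq_emod_eight_of_odd hb
        have h2 := sq_emod_eight_of_even (hc 0)
        have h3 := sq_emod_eight_of_even (hc 1)
        have h4 := sq_emod_eight_of_even (hc 2)
        have h5 := sq_emod_eight_of_even (hc 3)
        lia
      refine ⟨⟨hmem, ?_⟩, ?_⟩
      · simp only [quadReflection, Fin.insertNth_apply_same, Fin.insertNth_apply_succAbove]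
        refine ⟨ha, hb, fun j => ?_⟩
        have := hc j
        rw [Int.even_iff] at this
        rw [Int.odd_iff]
        lia
      · simp only [quadReflection, Fin.insertNth_apply_succAbove, sum_sub_distrib, sum_const,
          card_univ, Fintype.card_fin, nsmul_eq_mul]
        push_cast
        lia
    · simp only [mem_filter, allOdd_iff i]
      rintro p ⟨⟨h, ha, hb, hc⟩, hd⟩
      exact quadReflection_quadReflection i (hsum_odd hc)
    · simp only [mem_filter]
      rintro p ⟨h, ha, hb, hc⟩
      exact quadReflection_quadReflection i (hsum_even hc)
  lia

lemma sq_emod_four (z : ℤ) : z ^ 2 % 4 = z % 2 := by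
  rcases Int.even_or_odd' z with ⟨k, rfl | rfl⟩ <;> ring_nf <;> omega

open Finset Classical in
lemma card_not_allEven {m : ℤ} (hm : 8 ∣ m) :
    #{p ∈ repsFinset m | ¬ AllEven p} = #{p ∈ repsFinset m | AllOdd p} +
      ∑ i, #{p ∈ repsFinset m | OddPair i p} + ∑ i, #{p ∈ repsFinset m | EvenPair i p} := by
  simp only [card_filter]
  rw [sum_comm, sum_comm (s := univ), ← sum_add_distrib, ← sum_add_distrib]
  refine sum_congr rfl fun p hp => ?_
  rw [mem_repsFinset_iff, mem_reps, Fin.sum_univ_five] at hp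
  have hx := sq_emod_four (p.1 0)
  have h0 := sq_emod_four (p.2 0)
  have h1 := sq_emod_four (p.2 1)
  have h2 := sq_emod_four (p.2 2)
  have h3 := sq_emod_four (p.2 3)
  have h4 := sq_emod_four (p.2 4)
  simp only [AllEven, AllOdd, OddPair, EvenPair, Fin.sum_univ_five,
    Fin.forall_fin_succ, Int.even_iff, Int.odd_iff]
  rcases Int.emod_two_eq_zero_or_one (p.1 0) with ex | ex <;>
  rcases Int.emod_two_eq_zero_or_one (p.2 0) with e0 | e0 <;>
  rcases Int.emod_two_eq_zero_or_one (p.2 1) with e1 | e1 <;>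
  rcases Int.emod_two_eq_zero_or_one (p.2 2) with e2 | e2 <;>
  rcases Int.emod_two_eq_zero_or_one (p.2 3) with e3 | e3 <;>
  rcases Int.emod_two_eq_zero_or_one (p.2 4) with e4 | e4 <;>
  first
  | (exfalso; lia)
  | simp [Fin.succAbove, ex, e0, e1, e2, e3, e4]

lemma N_div_four {m : ℤ} (hm : 4 ∣ m) :
    N 1 5 (m / 4) = {p ∈ reps m | AllEven p}.ncard := by
  change (reps (m / 4)).ncard = _
  refine Set.ncard_congr (fun p _ => 2 • p) ?_ ?_ ?_
  · intro p hp
    rw [mem_reps] at hp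
    refine ⟨?_, ?_, fun j => ?_⟩
    · simp [mem_reps, mul_pow, ← Finset.mul_sum]
      lia
    · simp
    · simp
  · intro p q _ _ h
    exact smul_right_injective _ two_ne_zero h
  · rintro p ⟨hp, hx, hy⟩
    have h2 : p = 2 • (fun i => p.1 i / 2, fun j => p.2 j / 2) := by
      refine rep_ext 0 ?_ ?_ fun j => ?_
      · simp [Int.mul_ediv_cancel' hx.two_dvd]
      · simp [Int.mul_ediv_cancel' (hy _).two_dvd]
      · simp [Int.mul_ediv_cancel' (hy _).two_dvd]
    refine ⟨_, ?_, h2.symm⟩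
    rw [h2, mem_reps] at hp
    rw [mem_reps]
    simp [mul_pow, ← Finset.mul_sum] at hp ⊢
    lia

theorem stmt_7 (n : ℕ) :
    6 * (Nstar 1 5 (8 * (n : ℤ) + 16) : ℤ) = Ntilde 1 5 (8 * (n : ℤ) + 16) := by
  classical
  set m : ℤ := 8 * (n : ℤ) + 16 with hm
  have h8 : 8 ∣ m := by lia
  have h4 : 4 ∣ m := by lia
  have hcard (P : (Fin 1 → ℤ) × (Fin 5 → ℤ) → Prop) :
      {p ∈ reps m | P p}.ncard = ({p ∈ repsFinset m | P p} : Finset _).card := by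
    rw [← Set.ncard_coe_finset]
    congr 1
    ext p
    simp [mem_repsFinset_iff]
  have hstar : Nstar 1 5 m = ({p ∈ repsFinset m | AllOdd p} : Finset _).card := by
    rw [← hcard, Nstar]
    congr 1
    ext p
    simp [mem_reps, AllOdd]
    tauto
  have hN : N 1 5 m = (repsFinset m).card := by
    rw [repsFinset, ← Set.ncard_eq_toFinset_card _ (finite_reps m)]
    rfl
  have hsplit := Finset.card_filter_add_card_filter_not (s := repsFinset m) AllEven
  have hclass := card_not_allEven h8
  have hodd := fun i => card_allOdd_eq_two_mul_card_oddPair i h8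
  have heven := fun i => card_allOdd_eq_two_mul_card_evenPair i h8
  rw [Fin.sum_univ_five, Fin.sum_univ_five] at hclass
  have := hodd 0
  have := hodd 1
  have := hodd 2
  have := hodd 3
  have := hodd 4
  have := heven 0
  have := heven 1
  have := heven 2
  have := heven 3
  have := heven 4
  rw [Ntilde, if_pos h4, N_div_four h4, hcard, hstar, hN]
  lia
end

section
/- Let a ≥ 2 be an even integer. If there exists a rational constant C such that N*(a,0; 8n+a) = C · N(a,0; 8n+a) for all nonnegative integers n, then a ∈ {2, 4, 6}. -/
open Filter Asymptotics Topology

theorem hasSum_fin_pi_prod {β : Type*} {k : ℕ} {f : Fin k → β → ℝ} {s : Fin k → ℝ}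
    (hf : ∀ i, 0 ≤ f i) (hs : ∀ i, HasSum (f i) (s i)) :
    HasSum (fun v : Fin k → β => ∏ i, f i (v i)) (∏ i, s i) := by
  induction k with
  | zero => simp
  | succ k ih =>
    have htail := ih (fun i => hf i.succ) (fun i => hs i.succ)
    have hsummable := (hs 0).summable.mul_of_nonneg htail.summable (hf 0)
      (fun v => Finset.prod_nonneg fun i _ => hf i.succ (v i))
    have h := (hs 0).mul htail hsummable
    rw [Fin.prod_univ_succ, ← (Fin.consEquiv fun _ : Fin (k + 1) => β).hasSum_iff]
    refine h.congr_fun ?_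
    intro p
    simp [Fin.prod_univ_succ, Fin.consEquiv]

/-- The theta series of a residue class modulo `4`, after the modular inversion. -/
theorem hasSum_theta_zmod_four (r : ZMod 4) {s : ℝ} (hs : 0 < s) :
    HasSum (fun n : ℤ => if (n : ZMod 4) = r then Real.exp (-Real.pi * n ^ 2 / (16 * s)) else 0)
      (√s * HurwitzZeta.cosKernel (((r.val : ℝ) / 4 : ℝ) : UnitAddCircle) s) := by
  have h := HurwitzZeta.hasSum_int_evenKernel ((r.val : ℝ) / 4) (inv_pos.2 hs)
  rw [HurwitzZeta.evenKernel_functional_equation, one_div s⁻¹, inv_inv, ← Real.sqrt_eq_rpow,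
    Real.sqrt_inv, one_div, inv_inv] at h
  have hinj : Function.Injective (fun n : ℤ => 4 * n + (r.val : ℤ)) := fun m n hmn => by
    simpa using hmn
  rw [← hinj.hasSum_iff]
  · refine h.congr_fun fun n => ?_
    have hr : (((4 * n + (r.val : ℤ) : ℤ)) : ZMod 4) = r := by
      have h4 : (4 : ZMod 4) = 0 := by decide
      push_cast
      simp [h4]
    simp only [Function.comp_apply, hr, if_true]
    congr 1
    push_cast
    field_simp
    ring
  · intro n hn
    refine if_neg fun hnr => hn ⟨n / 4, ?_⟩
    have hval : ((r.val : ℕ) : ℤ) = n % 4 := by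
      rw [← hnr, ZMod.val_intCast]
      rfl
    simp only [hval]
    omega

theorem hasSum_weighted_theta {k : ℕ} (w : (Fin k → ZMod 4) → ℝ) {s : ℝ} (hs : 0 < s) :
    HasSum (fun v : Fin k → ℤ =>
        w (fun i => (v i : ZMod 4)) * Real.exp (-Real.pi * (∑ i, v i ^ 2 : ℤ) / (16 * s)))
      (√s ^ k * ∑ r, w r *
        ∏ i, HurwitzZeta.cosKernel ((((r i).val : ℝ) / 4 : ℝ) : UnitAddCircle) s) := by
  have h := hasSum_sum (s := Finset.univ) fun (r : Fin k → ZMod 4) _ =>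
    (hasSum_fin_pi_prod (f := fun i (n : ℤ) => if (n : ZMod 4) = r i then
        Real.exp (-Real.pi * n ^ 2 / (16 * s)) else 0)
      (fun i n => by dsimp only; split_ifs <;> simp [Real.exp_nonneg])
      (fun i => hasSum_theta_zmod_four (r i) hs)).mul_left (w r)
  have hsum : ∑ r, w r * ∏ i, √s *
      HurwitzZeta.cosKernel ((((r i).val : ℝ) / 4 : ℝ) : UnitAddCircle) s = √s ^ k * ∑ r, w r *
        ∏ i, HurwitzZeta.cosKernel ((((r i).val : ℝ) / 4 : ℝ) : UnitAddCircle) s := by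
    rw [Finset.mul_sum]
    refine Finset.sum_congr rfl fun r _ => ?_
    rw [Finset.prod_mul_distrib, Finset.prod_const, Finset.card_univ, Fintype.card_fin]
    ring
  rw [← hsum]
  refine h.congr_fun fun v => ?_
  rw [Finset.sum_eq_single (fun i => (v i : ZMod 4))]
  · simp only [if_true, ← Real.exp_sum]
    congr 2
    push_cast
    rw [Finset.mul_sum, Finset.sum_div]
  · intro r _ hr
    obtain ⟨i, hi⟩ := Function.ne_iff.1 hr
    rw [Finset.prod_eq_zero (Finset.mem_univ i) (if_neg hi.symm), mul_zero]
  · simp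

theorem isLittleO_prod_sub_one {α ι : Type*} {l : Filter α} {g : α → ℝ} (t : Finset ι)
    {f : ι → α → ℝ} (hg : Tendsto g l (𝓝 0)) (hf : ∀ i ∈ t, (fun x => f i x - 1) =o[l] g) :
    (fun x => ∏ i ∈ t, f i x - 1) =o[l] g := by
  classical
  induction t using Finset.induction_on with
  | empty => simp
  | insert j t hj ih =>
    have h1 := ih fun i hi => hf i (Finset.mem_insert_of_mem hi)
    have h2 := hf j (Finset.mem_insert_self j t)
    have hlim : Tendsto (f j) l (𝓝 1) := by
      simpa using (h2.isBigO.trans_tendsto hg).add_const 1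
    have h3 : (fun x => f j x * (∏ i ∈ t, f i x - 1)) =o[l] g := by
      simpa using (hlim.isBigO_one ℝ).mul_isLittleO h1
    refine (h3.add h2).congr_left fun x => ?_
    rw [Finset.prod_insert hj]
    ring

theorem isLittleO_cosKernel_sub_one (x : UnitAddCircle) (k : ℕ) :
    (fun s => HurwitzZeta.cosKernel x s - 1) =o[atTop] fun s => (√s ^ k)⁻¹ := by
  obtain ⟨p, hp, h⟩ := HurwitzZeta.isBigO_atTop_cosKernel_sub x
  refine (h.trans_isLittleO (isLittleO_exp_neg_mul_rpow_atTop hp (-(k / 2 : ℝ)))).congr' .rfl ?_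
  filter_upwards [eventually_ge_atTop 0] with s hs
  rw [Real.rpow_neg hs, Real.sqrt_eq_rpow, ← Real.rpow_natCast, ← Real.rpow_mul hs]
  congr 2
  ring

/-- If the sums of a weight modulo `4` over large spheres vanish, then so does the sum of
the remaining sphere sums. -/
theorem sum_sphere_weights_eq_zero {k : ℕ} (hk : k ≠ 0) (w : (Fin k → ZMod 4) → ℝ) (M : ℤ)
    (hM : ∀ m, M ≤ m →
      ∑' v : (fun v : Fin k → ℤ => ∑ i, v i ^ 2) ⁻¹' {m}, w (fun i => (v.1 i : ZMod 4)) = 0) :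
    ∑ m ∈ Finset.Ico 0 M,
      ∑' v : (fun v : Fin k → ℤ => ∑ i, v i ^ 2) ⁻¹' {m}, w (fun i => (v.1 i : ZMod 4)) = 0 := by
  set c : ℤ → ℝ := fun m =>
    ∑' v : (fun v : Fin k → ℤ => ∑ i, v i ^ 2) ⁻¹' {m}, w (fun i => (v.1 i : ZMod 4)) with hc
  set K : ℝ → ℝ := fun s => ∑ r, w r *
    ∏ i, HurwitzZeta.cosKernel ((((r i).val : ℝ) / 4 : ℝ) : UnitAddCircle) s with hK
  have hc_neg (m : ℤ) (hm : m < 0) : c m = 0 := by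
    have : IsEmpty ((fun v : Fin k → ℤ => ∑ i, v i ^ 2) ⁻¹' {m}) := by
      refine ⟨fun v => ?_⟩
      have hv : ∑ i, v.1 i ^ 2 = m := v.2
      have : 0 ≤ ∑ i, v.1 i ^ 2 := Finset.sum_nonneg fun i _ => sq_nonneg _
      omega
    exact tsum_empty
  have hfin {s : ℝ} (hs : 0 < s) : √s ^ k * K s =
      ∑ m ∈ Finset.Ico 0 M, c m * Real.exp (-Real.pi * m / (16 * s)) := by
    have h := (hasSum_weighted_theta w hs).tsum_fiberwise (fun v : Fin k → ℤ => ∑ i, v i ^ 2)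
    refine h.unique ?_
    have hterm (m : ℤ) : (∑' v : (fun v : Fin k → ℤ => ∑ i, v i ^ 2) ⁻¹' {m},
        w (fun i => (v.1 i : ZMod 4)) * Real.exp (-Real.pi * (∑ i, v.1 i ^ 2 : ℤ) / (16 * s))) =
        c m * Real.exp (-Real.pi * m / (16 * s)) := by
      rw [hc, ← tsum_mul_right]
      refine tsum_congr fun v => ?_
      have hv : ∑ i, v.1 i ^ 2 = m := v.2
      rw [hv]
    simp only [hterm]
    refine hasSum_sum_of_ne_finset_zero fun m hm => ?_
    rw [Finset.mem_Ico, not_and_or, not_le, not_lt] at hm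
    rcases hm with hm | hm
    · rw [hc_neg m hm, zero_mul]
    · rw [show c m = 0 from hM m hm, zero_mul]
  have hlim : Tendsto (fun s => √s ^ k * K s) atTop (𝓝 (∑ m ∈ Finset.Ico 0 M, c m)) := by
    have h : Tendsto (fun s : ℝ => ∑ m ∈ Finset.Ico 0 M,
        c m * Real.exp (-Real.pi * m / (16 * s))) atTop (𝓝 (∑ m ∈ Finset.Ico 0 M, c m)) := by
      refine tendsto_finsetSum _ fun m _ => ?_
      have h0 : Tendsto (fun s : ℝ => -Real.pi * m / (16 * s)) atTop (𝓝 0) :=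
        tendsto_const_nhds.div_atTop (tendsto_id.const_mul_atTop (by norm_num))
      simpa using ((Real.continuous_exp.tendsto 0).comp h0).const_mul (c m)
    refine h.congr' ?_
    filter_upwards [eventually_gt_atTop 0] with s hs using (hfin hs).symm
  have hpow : Tendsto (fun s : ℝ => √s ^ k) atTop atTop :=
    (tendsto_pow_atTop hk).comp Real.tendsto_sqrt_atTop
  have hKo : (fun s => K s - ∑ r, w r) =o[atTop] fun s => (√s ^ k)⁻¹ := by
    have h := IsLittleO.sum (s := Finset.univ) fun (r : Fin k → ZMod 4) _ =>
      (isLittleO_prod_sub_one Finset.univ hpow.inv_tendsto_atTop fun i _ =>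
        isLittleO_cosKernel_sub_one ((((r i).val : ℝ) / 4 : ℝ) : UnitAddCircle) k).const_mul_left
          (w r)
    refine h.congr_left fun s => ?_
    simp only [Finset.sum_apply, hK, mul_sub, mul_one, Finset.sum_sub_distrib]
  have hrem : Tendsto (fun s => √s ^ k * (K s - ∑ r, w r)) atTop (𝓝 0) := by
    refine hKo.tendsto_div_nhds_zero.congr fun s => ?_
    rw [div_inv_eq_mul, mul_comm]
  have hK0 : Tendsto K atTop (𝓝 0) := by
    have h := hpow.inv_tendsto_atTop.mul hlim
    rw [zero_mul] at h
    refine h.congr' ?_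
    filter_upwards [eventually_gt_atTop 0] with s hs
    have : √s ^ k ≠ 0 := pow_ne_zero _ (Real.sqrt_pos.2 hs).ne'
    simp [this]
  have hw : ∑ r, w r = 0 := by
    have h1 : Tendsto K atTop (𝓝 (∑ r, w r)) := by
      simpa using (hKo.isBigO.trans_tendsto hpow.inv_tendsto_atTop).add_const (∑ r, w r)
    exact tendsto_nhds_unique h1 hK0
  simp only [hw, sub_zero] at hrem
  exact tendsto_nhds_unique hlim hrem

theorem finite_sum_sq_eq (k : ℕ) (m : ℤ) : {v : Fin k → ℤ | ∑ i, v i ^ 2 = m}.Finite := by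
  refine (Set.finite_Icc (fun _ => -m) (fun _ => m)).subset fun v hv => ?_
  have hv : ∑ i, v i ^ 2 = m := hv
  have hi (i : Fin k) : v i ^ 2 ≤ m := hv ▸
    Finset.single_le_sum (f := fun i => v i ^ 2) (fun i _ => sq_nonneg _) (Finset.mem_univ i)
  refine ⟨fun i => ?_, fun i => ?_⟩
  · have := hi i
    have := Int.le_self_sq (-v i)
    simp only
    nlinarith
  · have := hi i
    have := Int.le_self_sq (v i)
    simp only
    nlinarith

theorem N_zero_right (k : ℕ) (m : ℤ) : N k 0 m = {v : Fin k → ℤ | ∑ i, v i ^ 2 = m}.ncard := by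
  unfold N
  refine Set.ncard_congr (fun p _ => p.1) ?_ ?_ ?_
  · rintro p hp
    simpa [eq_comm] using hp
  · rintro p q _ _ h
    exact Prod.ext h (Subsingleton.elim _ _)
  · rintro v hv
    exact ⟨(v, Fin.elim0), by simpa [eq_comm] using hv, rfl⟩

theorem Nstar_zero_right (k : ℕ) (m : ℤ) :
    Nstar k 0 m = {v : Fin k → ℤ | (∀ i, Odd (v i)) ∧ ∑ i, v i ^ 2 = m}.ncard := by
  unfold Nstar
  refine Set.ncard_congr (fun p _ => p.1) ?_ ?_ ?_
  · rintro p hp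
    simpa [eq_comm] using hp
  · rintro p q _ _ h
    exact Prod.ext h (Subsingleton.elim _ _)
  · rintro v hv
    exact ⟨(v, Fin.elim0), by simpa [eq_comm] using hv, rfl⟩

theorem sum_sq_emod_eight_of_odd {k : ℕ} {v : Fin k → ℤ} (hv : ∀ i, Odd (v i)) :
    ∑ i, v i ^ 2 ≡ k [ZMOD 8] := by
  have h : ∑ i, v i ^ 2 ≡ ∑ _i : Fin k, 1 [ZMOD 8] :=
    Int.ModEq.sum fun i _ => (Int.modEq_iff_dvd.2 (Int.eight_dvd_sq_sub_one_of_odd (hv i))).symm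
  simpa using h

theorem le_sum_sq_of_odd {k : ℕ} {v : Fin k → ℤ} (hv : ∀ i, Odd (v i)) :
    (k : ℤ) ≤ ∑ i, v i ^ 2 := by
  have h : ∑ _i : Fin k, (1 : ℤ) ≤ ∑ i, v i ^ 2 := Finset.sum_le_sum fun i _ => by
    have : v i ≠ 0 := by
      rintro h
      simpa [h] using hv i
    have := sq_pos_of_ne_zero this
    omega
  simpa using h

theorem exists_sum_sq_eq {j k : ℕ} (hjk : j ≤ k) : ∃ v : Fin k → ℤ, ∑ i, v i ^ 2 = j := by
  obtain ⟨d, rfl⟩ := Nat.exists_eq_add_of_le hjk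
  exact ⟨Fin.append (fun _ => 1) (fun _ => 0), by simp [Fin.sum_univ_add]⟩

open Classical in
/-- The weight counting odd vectors minus `C` times those whose norm is `k` modulo `8`. -/
noncomputable def oddWeight (k : ℕ) (C : ℝ) (r : Fin k → ZMod 4) : ℝ :=
  (if ∀ i, Odd ((r i).val : ℤ) then 1 else 0) -
    C * if ∑ i, ((r i).val : ℤ) ^ 2 ≡ k [ZMOD 8] then 1 else 0

open Classical in
theorem oddWeight_intCast {k : ℕ} (C : ℝ) (v : Fin k → ℤ) :
    oddWeight k C (fun i => (v i : ZMod 4)) =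
      (if ∀ i, Odd (v i) then 1 else 0) - C * if ∑ i, v i ^ 2 ≡ k [ZMOD 8] then 1 else 0 := by
  have hval (n : ℤ) : (((n : ZMod 4).val : ℕ) : ℤ) = n % 4 := by
    rw [ZMod.val_intCast]
    rfl
  have hodd (n : ℤ) : Odd (n % 4) ↔ Odd n := by
    rw [Int.odd_iff, Int.odd_iff]
    omega
  have hsq (n : ℤ) : (n % 4) ^ 2 ≡ n ^ 2 [ZMOD 8] := by
    refine Int.modEq_iff_dvd.2 ⟨2 * (n / 4) ^ 2 + (n / 4) * (n % 4), ?_⟩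
    have h := Int.emod_add_mul_ediv n 4
    generalize n % 4 = x at *
    generalize n / 4 = y at *
    subst h
    ring
  have hsum : ∑ i, (v i % 4) ^ 2 ≡ ∑ i, v i ^ 2 [ZMOD 8] :=
    Int.ModEq.sum fun i _ => hsq (v i)
  have hiff : ∑ i, (v i % 4) ^ 2 ≡ k [ZMOD 8] ↔ ∑ i, v i ^ 2 ≡ k [ZMOD 8] :=
    ⟨hsum.symm.trans, hsum.trans⟩
  simp only [oddWeight, hval, hodd, hiff]

theorem tsum_oddWeight {k : ℕ} (C : ℝ) (m : ℤ) :
    ∑' v : (fun v : Fin k → ℤ => ∑ i, v i ^ 2) ⁻¹' {m},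
        oddWeight k C (fun i => (v.1 i : ZMod 4)) =
      Nstar k 0 m - C * if m ≡ k [ZMOD 8] then (N k 0 m : ℝ) else 0 := by
  classical
  have hset : (fun v : Fin k → ℤ => ∑ i, v i ^ 2) ⁻¹' {m} = ↑(finite_sum_sq_eq k m).toFinset := by
    ext v
    simp
  have hstar : Nstar k 0 m =
      ((finite_sum_sq_eq k m).toFinset.filter fun v => ∀ i, Odd (v i)).card := by
    rw [Nstar_zero_right, ← Set.ncard_coe_finset]
    congr 1
    ext v
    simp [and_comm]
  rw [hset, Finset.tsum_subtype' _ fun v : Fin k → ℤ => oddWeight k C (fun i => (v i : ZMod 4)),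
    hstar, N_zero_right, Set.ncard_eq_toFinset_card _ (finite_sum_sq_eq k m)]
  simp only [oddWeight_intCast, Finset.sum_sub_distrib, ← Finset.mul_sum, Finset.sum_boole]
  congr 2
  have hm : ∀ v ∈ (finite_sum_sq_eq k m).toFinset, ∑ i, v i ^ 2 = m := by simp
  split_ifs with h
  · rw [Finset.filter_true_of_mem fun v hv => by rwa [hm v hv]]
  · rw [Finset.filter_false_of_mem fun v hv => by rwa [hm v hv]]
    simp

theorem stmt_8 (a : ℕ) (ha : 2 ≤ a) (haeven : Even a)
    (h : ∃ C : ℚ, ∀ n : ℕ,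
        (Nstar a 0 (8 * (n : ℤ) + a) : ℚ) = C * (N a 0 (8 * (n : ℤ) + a) : ℚ)) :
    a = 2 ∨ a = 4 ∨ a = 6 := by
  obtain ⟨C, hC⟩ := h
  by_contra hne
  have ha8 : 8 ≤ a := by
    obtain ⟨b, rfl⟩ := haeven
    omega
  have hC0 : (C : ℝ) ≠ 0 := by
    rintro h0
    have hpos : 0 < Nstar a 0 a := by
      rw [Nstar_zero_right]
      exact (Set.ncard_pos ((finite_sum_sq_eq a a).subset fun v hv => hv.2)).2
        ⟨fun _ => 1, by simp⟩
    have := hC 0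
    simp only [Rat.cast_eq_zero] at h0
    simp [h0] at this
    omega
  have key := sum_sphere_weights_eq_zero (by omega) (oddWeight a C) a fun m hm => by
    rw [tsum_oddWeight]
    by_cases hmod : m ≡ a [ZMOD 8]
    · obtain ⟨d, hd⟩ := hmod.symm.dvd
      obtain ⟨n, rfl⟩ : ∃ n : ℕ, d = n := ⟨d.toNat, by omega⟩
      obtain rfl : m = 8 * (n : ℤ) + a := by omega
      rw [if_pos hmod, sub_eq_zero]
      exact_mod_cast hC n
    · have hempty : {v : Fin a → ℤ | (∀ i, Odd (v i)) ∧ ∑ i, v i ^ 2 = m} = ∅ := by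
        ext v
        simp only [Set.mem_ofPred_eq, Set.mem_empty_iff_false, iff_false, not_and]
        rintro hv rfl
        exact hmod (sum_sq_emod_eight_of_odd hv)
      rw [if_neg hmod, Nstar_zero_right, hempty]
      simp
  have hstar (m : ℤ) (hm : m ∈ Finset.Ico 0 (a : ℤ)) : Nstar a 0 m = 0 := by
    have hempty : {v : Fin a → ℤ | (∀ i, Odd (v i)) ∧ ∑ i, v i ^ 2 = m} = ∅ := by
      ext v
      simp only [Set.mem_ofPred_eq, Set.mem_empty_iff_false, iff_false, not_and]
      rintro hv rfl
      exact (Finset.mem_Ico.1 hm).2.not_ge (le_sum_sq_of_odd hv)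
    rw [Nstar_zero_right, hempty, Set.ncard_empty]
  rw [Finset.sum_congr rfl fun m hm => by
      rw [tsum_oddWeight, hstar m hm, Nat.cast_zero, zero_sub, ← mul_neg],
    ← Finset.mul_sum, mul_eq_zero, or_iff_right hC0, Finset.sum_neg_distrib, neg_eq_zero,
    Finset.sum_eq_zero_iff_of_nonneg fun m _ => by split_ifs <;> positivity] at key
  have hmem : ((a - 8 : ℕ) : ℤ) ∈ Finset.Ico 0 (a : ℤ) := Finset.mem_Ico.2 (by omega)
  have hmod : ((a - 8 : ℕ) : ℤ) ≡ a [ZMOD 8] := by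
    rw [Int.modEq_iff_dvd]
    omega
  have hzero := key _ hmem
  rw [if_pos hmod, Nat.cast_eq_zero, N_zero_right,
    Set.ncard_eq_zero (finite_sum_sq_eq a _)] at hzero
  obtain ⟨v, hv⟩ := exists_sum_sq_eq (Nat.sub_le a 8)
  exact hzero.subset hv
end

section
/- Let a, b be nonnegative integers, both even, with a + b = 4k ≥ 4. Then there exists a cusp form C of weight 2k on Γ₀(48) (with trivial character) such that for all z in the upper half-plane: Ψ₈^a(z)·Ψ₈^b(3z) = a_{1,4}·[((−3)^{a/2}−1)·E_{2k}(4z) + (3^{2k}−(−3)^{a/2})·E_{2k}(12z)] + a_{1,8}·[((−3)^{a/2}−1)·E_{2k}(8z) + (3^{2k}−(−3)^{a/2})·E_{2k}(24z)] + a_{1,16}·[((−3)^{a/2}−1)·E_{2k}(16z) + (3^{2k}−(−3)^{a/2})·E_{2k}(48z)] + C(z), where a_{1,4} = ((−1)^{(a+3b)/4} − 1)/(2^{4k}(2^{2k}−1)(3^{2k}−1)), a_{1,8} = (2^{2k} + 1 − (−1)^{(a+3b)/4})/(2^{4k}(2^{2k}−1)(3^{2k}−1)), and a_{1,16} = −2^{2k}/(2^{4k}(2^{2k}−1)(3^{2k}−1)).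 -/
open Complex

/-- `Ψ(z) = Σ_{m ≥ 1} q^{m(m-1)/2 + 1/8}` with `q = e^{2πiz}`, as a function of `z ∈ ℂ`. -/
noncomputable def Psi (z : ℂ) : ℂ :=
  ∑' m : ℕ, Complex.exp (2 * Real.pi * Complex.I * z * (((m : ℂ) + 1) * m / 2 + 1 / 8))

/-- The weight `2k` Eisenstein series
`E_{2k}(z) = 1 - (4k/B_{2k}) Σ_{n ≥ 1} σ_{2k-1}(n) q^n` with `q = e^{2πiz}`. -/
noncomputable def E2k (k : ℕ) (z : ℂ) : ℂ :=
  1 - (4 * k / (bernoulli (2 * k) : ℂ)) *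
    ∑' n : ℕ, (ArithmeticFunction.sigma (2 * k - 1) (n + 1) : ℂ) *
      Complex.exp (2 * Real.pi * Complex.I * (n + 1) * z)

section Helpers

open UpperHalfPlane hiding I
open Filter Topology MatrixGroups
open scoped Real Manifold ModularForm

/-! ### Theta constants -/

theorem hasSum_Psi {z : ℂ} (hz : 0 < z.im) :
    HasSum (fun m : ℕ ↦ cexp (2 * π * I * z * (((m : ℂ) + 1) * m / 2 + 1 / 8)))
      (cexp (π * I * z / 4) * jacobiTheta₂ (z / 2) z / 2) := by
  have h := ((hasSum_jacobiTheta₂_term (z / 2) hz).nat_add_neg_add_one.mul_left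
    (cexp (π * I * z / 4))).div_const 2
  refine h.congr_fun fun m ↦ ?_
  have key : jacobiTheta₂_term (-(m + 1)) (z / 2) z = jacobiTheta₂_term m (z / 2) z := by
    simp only [jacobiTheta₂_term]
    congr 1
    push_cast
    ring
  rw [key, ← two_mul, mul_left_comm, mul_div_cancel_left₀ _ two_ne_zero, jacobiTheta₂_term,
    ← Complex.exp_add]
  congr 1
  push_cast
  ring

theorem Psi_eq_jacobiTheta₂ {z : ℂ} (hz : 0 < z.im) :
    Psi z = cexp (π * I * z / 4) * jacobiTheta₂ (z / 2) z / 2 :=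
  (hasSum_Psi hz).tsum_eq

theorem differentiableAt_Psi {z : ℂ} (hz : 0 < z.im) : DifferentiableAt ℂ Psi z := by
  have h : DifferentiableAt ℂ (fun z : ℂ ↦ jacobiTheta₂ (z / 2) z) z :=
    (hasFDerivAt_jacobiTheta₂ (z / 2) hz).differentiableAt.comp z
      (f := fun z : ℂ ↦ (z / 2, z)) (by fun_prop)
  have h2 : DifferentiableAt ℂ
      (fun z : ℂ ↦ cexp (π * I * z / 4) * jacobiTheta₂ (z / 2) z / 2) z := by fun_prop
  refine h2.congr_of_eventuallyEq ?_
  filter_upwards [(isOpen_lt continuous_const Complex.continuous_im).mem_nhds hz] with w hw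
  exact Psi_eq_jacobiTheta₂ hw

theorem Psi_add_one (z : ℂ) : Psi (z + 1) = cexp (π * I / 4) * Psi z := by
  rw [Psi, Psi, ← tsum_mul_left]
  refine tsum_congr fun m ↦ ?_
  obtain ⟨j, hj⟩ := (Nat.even_mul_succ_self m)
  have hj' : ((m : ℂ) + 1) * m = 2 * j := by
    rw [two_mul]; exact_mod_cast (mul_comm _ _).trans hj
  rw [hj', ← Complex.exp_add]
  have : 2 * π * I * (z + 1) * (2 * (j : ℂ) / 2 + 1 / 8) =
      (π * I / 4 + 2 * π * I * z * (2 * j / 2 + 1 / 8)) + j * (2 * π * I) := by ring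
  rw [this, Complex.exp_add _ (j * (2 * π * I)), exp_nat_mul_two_pi_mul_I, mul_one]

theorem Psi_add_one_sq (z : ℂ) : Psi (z + 1) ^ 2 = I * Psi z ^ 2 := by
  rw [Psi_add_one, mul_pow, ← Complex.exp_nat_mul]
  congr 1
  rw [show ((2 : ℕ) : ℂ) * (π * I / 4) = π / 2 * I by push_cast; ring, Complex.exp_pi_div_two_mul_I]

theorem jacobiTheta_add_one (z : ℂ) : jacobiTheta (z + 1) = jacobiTheta₂ (1 / 2) z := by
  rw [jacobiTheta_eq_jacobiTheta₂, jacobiTheta₂, jacobiTheta₂]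
  refine tsum_congr fun n ↦ ?_
  simp only [jacobiTheta₂_term]
  obtain ⟨j, hj⟩ := (Int.even_mul_succ_self n)
  have hj' : (n : ℂ) ^ 2 = 2 * j - n := by
    have : n ^ 2 = 2 * j - n := by linarith
    exact_mod_cast this
  have : 2 * π * I * (n : ℂ) * 0 + π * I * (n : ℂ) ^ 2 * (z + 1) =
    (2 * π * I * n * (1 / 2) + π * I * (n : ℂ) ^ 2 * z) + ((j - n : ℤ) : ℂ) * (2 * π * I) := by
    push_cast
    linear_combination (π * I) * hj'
  rw [this, Complex.exp_add _ (_ * (2 * π * I)), exp_int_mul_two_pi_mul_I, mul_one]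

theorem sq_cpow_half (w : ℂ) : (w ^ (1 / 2 : ℂ)) ^ 2 = w := by
  have := Complex.cpow_nat_inv_pow w (n := 2) two_ne_zero
  rwa [Nat.cast_ofNat, ← one_div] at this

theorem im_neg_one_div_pos {z : ℂ} (hz : 0 < z.im) : 0 < (-1 / z).im := by
  rw [neg_div, one_div, ← inv_neg]
  simpa using! (UpperHalfPlane.mk z hz).im_inv_neg_coe_pos

theorem jacobiTheta_S_sq {z : ℂ} (hz : 0 < z.im) :
    jacobiTheta (-1 / z) ^ 2 = -I * z * jacobiTheta z ^ 2 := by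
  have hz0 : z ≠ 0 := by rintro rfl; simp at hz
  have h0 : -I * z ≠ 0 := by simp [hz0]
  have h := jacobiTheta₂_functional_equation 0 z
  rw [jacobiTheta_eq_jacobiTheta₂, jacobiTheta_eq_jacobiTheta₂, h]
  simp only [mul_pow, div_pow, sq_cpow_half]
  simp
  field_simp
  simp

theorem Psi_S_sq {z : ℂ} (hz : 0 < z.im) :
    4 * Psi (-1 / z) ^ 2 = -I * z * jacobiTheta (z + 1) ^ 2 := by
  have hz0 : z ≠ 0 := by rintro rfl; simp at hz
  have h0 : -I * z ≠ 0 := by simp [hz0]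
  have h := jacobiTheta₂_functional_equation (1 / 2) z
  rw [Psi_eq_jacobiTheta₂ (im_neg_one_div_pos hz), jacobiTheta_add_one, h]
  have h1 : -1 / z / 2 = -(1 / 2 / z) := by field_simp
  have h2 : -π * I * (1 / 2) ^ 2 / z = π * I * (-1 / z) / 4 := by field_simp; norm_num
  rw [h1, jacobiTheta₂_neg_left, h2]
  simp only [mul_pow, div_pow, sq_cpow_half]
  field_simp
  norm_num

theorem jacobiTheta_S_add_one_sq {z : ℂ} (hz : 0 < z.im) :
    jacobiTheta (-1 / z + 1) ^ 2 = -I * z * (4 * Psi z ^ 2) := by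
  have hz0 : z ≠ 0 := by rintro rfl; simp at hz
  have h := Psi_S_sq (im_neg_one_div_pos hz)
  have h1 : -1 / (-1 / z) = z := by field_simp
  rw [h1] at h
  rw [h]
  field_simp
  simp

theorem I_zpow_eq_of_zmod {m n : ℤ} (h : (m : ZMod 4) = n) : I ^ m = I ^ n := by
  obtain ⟨j, hj⟩ := (ZMod.intCast_eq_intCast_iff_dvd_sub m n 4).1 h
  have h4 : I ^ ((4 : ℕ) : ℤ) = 1 := by rw [zpow_natCast, I_pow_four]
  rw [show n = m + (4 : ℕ) * j by linarith, zpow_add₀ I_ne_zero, zpow_mul, h4, one_zpow, mul_one]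

theorem two_mul_zmod_four_of_even {r : ℤ} (h : Even r) : (2 * r : ZMod 4) = 0 := by
  obtain ⟨j, rfl⟩ := h
  push_cast
  have h4 : (4 : ZMod 4) = 0 := by decide
  linear_combination (j : ZMod 4) * h4

theorem two_mul_zmod_four_of_odd {r : ℤ} (h : Odd r) : (2 * r : ZMod 4) = 2 := by
  obtain ⟨j, rfl⟩ := h
  push_cast
  have h4 : (4 : ZMod 4) = 0 := by decide
  linear_combination (j : ZMod 4) * h4

/-- The exponent of `I` in the automorphy factor of the square of the theta constant `2 Ψ` under
a matrix with entries `p, q, r, s`. -/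
def thetaExponent (p q r s : ℤ) : ℤ := if Even r then s * (q + 1) - 1 else r * (p + 1) + 2

/-- The square of the theta constant into which `(2 Ψ)²` is carried by a matrix with bottom row
`r, s`. -/
noncomputable def thetaSq (r s : ℤ) (z : ℂ) : ℂ :=
  if Even r then 4 * Psi z ^ 2
  else if Even s then jacobiTheta (z + 1) ^ 2 else jacobiTheta z ^ 2

theorem I_zpow_thetaExponent_mul_S {p q r s : ℤ} (h : p * s - q * r = 1) :
    I ^ thetaExponent p q r s * -I = I ^ thetaExponent q (-p) s (-r) := by
  have hI : -I = I ^ (3 : ℤ) := by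
    rw [show (3 : ℤ) = ((3 : ℕ) : ℤ) by rfl, zpow_natCast, I_pow_three]
  rw [hI, ← zpow_add₀ I_ne_zero]
  apply I_zpow_eq_of_zmod
  have h' : (p * s - q * r : ZMod 4) = 1 := by exact_mod_cast congrArg (Int.cast : ℤ → ZMod 4) h
  unfold thetaExponent
  rcases Int.even_or_odd r with hr | hr <;> rcases Int.even_or_odd s with hs | hs
  · obtain ⟨x, rfl⟩ := hr
    obtain ⟨y, rfl⟩ := hs
    exact absurd h (by ring_nf; omega)
  · have h1 := two_mul_zmod_four_of_even hr
    have h2 := two_mul_zmod_four_of_odd hs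
    simp only [hr, Int.not_even_iff_odd.2 hs, if_true, if_false]
    push_cast
    generalize (p : ZMod 4) = p, (q : ZMod 4) = q, (r : ZMod 4) = r, (s : ZMod 4) = s at *
    revert p q r s; decide
  · have h1 := two_mul_zmod_four_of_odd hr
    have h2 := two_mul_zmod_four_of_even hs
    simp only [hs, Int.not_even_iff_odd.2 hr, if_true, if_false]
    push_cast
    generalize (p : ZMod 4) = p, (q : ZMod 4) = q, (r : ZMod 4) = r, (s : ZMod 4) = s at *
    revert p q r s; decide
  · have h1 := two_mul_zmod_four_of_odd hr
    have h2 := two_mul_zmod_four_of_odd hs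
    simp only [Int.not_even_iff_odd.2 hs, Int.not_even_iff_odd.2 hr, if_false]
    push_cast
    generalize (p : ZMod 4) = p, (q : ZMod 4) = q, (r : ZMod 4) = r, (s : ZMod 4) = s at *
    revert p q r s; decide

theorem thetaSq_S (r s : ℤ) (h : ¬ (Even r ∧ Even s)) {z : ℂ} (hz : 0 < z.im) :
    thetaSq r s (-1 / z) = -I * z * thetaSq s (-r) z := by
  unfold thetaSq
  simp only [even_neg]
  split_ifs with h1 h2 h2
  · exact absurd ⟨h1, h2⟩ h
  · exact Psi_S_sq hz
  · exact jacobiTheta_S_add_one_sq hz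
  · exact jacobiTheta_S_sq hz

theorem I_zpow_thetaExponent_mul_thetaSq_T {p q r s : ℤ} (h : p * s - q * r = 1) (z : ℂ) :
    I ^ thetaExponent p q r s * thetaSq r s (z + 1) =
      I ^ thetaExponent p (q + p) r (s + r) * thetaSq r (s + r) z := by
  have h' : (p * s - q * r : ZMod 4) = 1 := by exact_mod_cast congrArg (Int.cast : ℤ → ZMod 4) h
  unfold thetaExponent thetaSq
  rcases Int.even_or_odd r with hr | hr
  · have h1 := two_mul_zmod_four_of_even hr
    simp only [hr, if_true]
    have hexp : I ^ (s * (q + 1) - 1) * I = I ^ ((s + r) * (q + p + 1) - 1) := by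
      rw [← zpow_add_one₀ I_ne_zero]
      apply I_zpow_eq_of_zmod
      push_cast
      generalize (p : ZMod 4) = p, (q : ZMod 4) = q, (r : ZMod 4) = r, (s : ZMod 4) = s at *
      revert p q r s; decide
    rw [Psi_add_one_sq, ← hexp]
    ring
  · have h1 := two_mul_zmod_four_of_odd hr
    have hr' := Int.not_even_iff_odd.2 hr
    simp only [hr', if_false, Int.even_add, iff_false]
    congr 1
    by_cases hs : Even s
    · simp only [hs, if_true, not_true, if_false]
      rw [add_assoc, one_add_one_eq_two, add_comm, jacobiTheta_two_add]
    · simp only [hs, if_false, not_false_eq_true, if_true]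

theorem theta_smul (γ : SL(2, ℤ)) : ∀ z : ℍ, 4 * Psi (γ • z : ℍ) ^ 2 =
    denom γ z * (I ^ thetaExponent (γ 0 0) (γ 0 1) (γ 1 0) (γ 1 1) *
      thetaSq (γ 1 0) (γ 1 1) z) := by
  have hmem : γ ∈ Subgroup.closure {ModularGroup.S, ModularGroup.T} := by
    simp [SpecialLinearGroup.SL2Z_generators]
  have hdet (γ : SL(2, ℤ)) : γ 0 0 * γ 1 1 - γ 0 1 * γ 1 0 = 1 := by
    rw [← Matrix.det_fin_two, γ.det_coe]
  have hS (z : ℍ) : ((ModularGroup.S • z : ℍ) : ℂ) = -1 / z := by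
    rw [UpperHalfPlane.modular_S_smul, UpperHalfPlane.coe_mk, inv_neg, neg_div, one_div]
  have hT (z : ℍ) : ((ModularGroup.T • z : ℍ) : ℂ) = z + 1 := by
    rw [UpperHalfPlane.modular_T_smul, UpperHalfPlane.coe_vadd, add_comm, ofReal_one]
  induction hmem using Subgroup.closure_induction_right with
  | one =>
    intro z
    simp [thetaExponent, thetaSq]
  | mul_right γ _ g hg ih =>
    intro z
    have hz0 := z.ne_zero
    have hd := hdet γ
    rw [mul_smul, ih, ModularGroup.denom_apply, ModularGroup.denom_apply]
    rcases hg with rfl | rfl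
    · obtain ⟨e00, e01, e10, e11⟩ : (γ * ModularGroup.S) 0 0 = γ 0 1 ∧
          (γ * ModularGroup.S) 0 1 = -γ 0 0 ∧ (γ * ModularGroup.S) 1 0 = γ 1 1 ∧
          (γ * ModularGroup.S) 1 1 = -γ 1 0 := by
        simp [Matrix.SpecialLinearGroup.coe_mul, ModularGroup.coe_S, Matrix.mul_apply,
          Fin.sum_univ_two]
      rw [hS, e00, e01, e10, e11, thetaSq_S _ _ ?_ z.im_pos, ← I_zpow_thetaExponent_mul_S hd]
      · push_cast
        field_simp
        ring
      · rintro ⟨⟨x, hx⟩, y, hy⟩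
        rw [hx, hy] at hd
        ring_nf at hd
        omega
    · obtain ⟨e00, e01, e10, e11⟩ : (γ * ModularGroup.T) 0 0 = γ 0 0 ∧
          (γ * ModularGroup.T) 0 1 = γ 0 1 + γ 0 0 ∧ (γ * ModularGroup.T) 1 0 = γ 1 0 ∧
          (γ * ModularGroup.T) 1 1 = γ 1 1 + γ 1 0 := by
        simp [Matrix.SpecialLinearGroup.coe_mul, ModularGroup.coe_T, Matrix.mul_apply,
          Fin.sum_univ_two, add_comm]
      rw [hT, e00, e01, e10, e11, I_zpow_thetaExponent_mul_thetaSq_T hd]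
      push_cast
      ring
  | mul_inv_cancel γ _ g hg ih =>
    intro z
    have hd := hdet γ
    rw [mul_smul, ih, ModularGroup.denom_apply, ModularGroup.denom_apply]
    rcases hg with rfl | rfl
    · obtain ⟨e00, e01, e10, e11⟩ : (γ * ModularGroup.S⁻¹) 0 0 = -γ 0 1 ∧
          (γ * ModularGroup.S⁻¹) 0 1 = γ 0 0 ∧ (γ * ModularGroup.S⁻¹) 1 0 = -γ 1 1 ∧
          (γ * ModularGroup.S⁻¹) 1 1 = γ 1 0 := by
        simp [Matrix.SpecialLinearGroup.coe_mul, Matrix.SpecialLinearGroup.coe_inv,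
          ModularGroup.coe_S, Matrix.mul_apply, Fin.sum_univ_two, Matrix.adjugate_fin_two]
      obtain ⟨w, rfl⟩ : ∃ w, z = ModularGroup.S • w := ⟨ModularGroup.S⁻¹ • z, by simp⟩
      have hw0 := w.ne_zero
      have hexp := I_zpow_thetaExponent_mul_S (p := -γ 0 1) (q := γ 0 0) (r := -γ 1 1)
        (s := γ 1 0) (by linarith)
      simp only [neg_neg] at hexp
      rw [inv_smul_smul, hS, e00, e01, e10, e11, thetaSq_S _ _ ?_ w.im_pos, ← hexp, neg_neg]
      · push_cast
        field_simp
        ring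
      · rintro ⟨⟨x, hx⟩, y, hy⟩
        rw [neg_eq_iff_eq_neg] at hx
        rw [hx, hy] at hd
        ring_nf at hd
        omega
    · obtain ⟨e00, e01, e10, e11⟩ : (γ * ModularGroup.T⁻¹) 0 0 = γ 0 0 ∧
          (γ * ModularGroup.T⁻¹) 0 1 = γ 0 1 - γ 0 0 ∧ (γ * ModularGroup.T⁻¹) 1 0 = γ 1 0 ∧
          (γ * ModularGroup.T⁻¹) 1 1 = γ 1 1 - γ 1 0 := by
        simp [Matrix.SpecialLinearGroup.coe_mul, Matrix.SpecialLinearGroup.coe_inv,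
          ModularGroup.coe_T, Matrix.mul_apply, Fin.sum_univ_two, Matrix.adjugate_fin_two,
          sub_eq_neg_add]
      obtain ⟨w, rfl⟩ : ∃ w, z = ModularGroup.T • w := ⟨ModularGroup.T⁻¹ • z, by simp⟩
      have hexp := I_zpow_thetaExponent_mul_thetaSq_T (p := γ 0 0) (q := γ 0 1 - γ 0 0)
        (r := γ 1 0) (s := γ 1 1 - γ 1 0) (by linarith) w
      simp only [sub_add_cancel] at hexp
      rw [inv_smul_smul, hT, e00, e01, e10, e11, hexp]
      push_cast
      ring
/-! ### Behaviour at infinity -/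

theorem tendsto_tsum_cexp {c : ℕ → ℂ} {x : ℕ → ℝ} (hx : ∀ n, 0 < x n)
    (hs : Summable fun n ↦ c n * cexp (2 * π * I * I * x n)) :
    Tendsto (fun z : ℂ ↦ ∑' n, c n * cexp (2 * π * I * z * x n)) (comap Complex.im atTop) (𝓝 0) := by
  have hnorm (z : ℂ) (n : ℕ) : ‖cexp (2 * π * I * z * x n)‖ = Real.exp (-(2 * π * x n) * z.im) := by
    rw [Complex.norm_exp]
    congr 1
    simp
    ring
  rw [show (0 : ℂ) = ∑' n : ℕ, (0 : ℂ) by simp]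
  refine tendsto_tsum_of_dominated_convergence hs.norm (fun n ↦ ?_) ?_
  · rw [← mul_zero (c n)]
    refine Tendsto.const_mul _ (tendsto_zero_iff_norm_tendsto_zero.2 ?_)
    simp only [hnorm]
    refine Real.tendsto_exp_atBot.comp (Tendsto.const_mul_atTop_of_neg ?_ tendsto_comap)
    have := hx n
    have := Real.pi_pos
    nlinarith
  · filter_upwards [tendsto_comap.eventually (eventually_ge_atTop 1)] with z hz n
    rw [norm_mul, norm_mul, hnorm, hnorm]
    gcongr ?_ * Real.exp ?_
    simp only [Complex.I_im]
    have : 0 < 2 * π * x n := by have := hx n; positivity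
    nlinarith

theorem tendsto_Psi : Tendsto Psi (comap Complex.im atTop) (𝓝 0) := by
  have h := tendsto_tsum_cexp (c := fun _ ↦ 1) (x := fun m : ℕ ↦ ((m : ℝ) + 1) * m / 2 + 1 / 8)
    (fun m ↦ by positivity) (by simpa using (hasSum_Psi (z := I) (by simp)).summable)
  refine h.congr fun z ↦ ?_
  simp [Psi]

theorem tendsto_jacobiTheta : Tendsto jacobiTheta (comap Complex.im atTop) (𝓝 1) := by
  rw [← tendsto_sub_nhds_zero_iff]
  refine isBigO_at_im_infty_jacobiTheta_sub_one.trans_tendsto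
    (Real.tendsto_exp_atBot.comp (Tendsto.const_mul_atTop_of_neg ?_ tendsto_comap))
  linarith [Real.pi_pos]

theorem tendsto_thetaSq {r s : ℤ} :
    Tendsto (thetaSq r s) (comap Complex.im atTop) (𝓝 (if Even r then 0 else 1)) := by
  unfold thetaSq
  have hT : Tendsto (fun z : ℂ ↦ z + 1) (comap Complex.im atTop) (comap Complex.im atTop) :=
    tendsto_comap_iff.2 (tendsto_comap.congr fun z ↦ by simp)
  split_ifs
  · simpa using (tendsto_Psi.pow 2).const_mul 4
  · simpa using (tendsto_jacobiTheta.comp hT).pow 2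
  · simpa using tendsto_jacobiTheta.pow 2

/-! ### Eisenstein series -/

theorem E2k_eq_tsum_pnat (k : ℕ) (z : ℂ) :
    E2k k z = 1 - (2 * (2 * k : ℕ) / (bernoulli (2 * k) : ℂ)) *
      ∑' n : ℕ+, (ArithmeticFunction.sigma (2 * k - 1) n : ℂ) *
        cexp (2 * π * I * z) ^ (n : ℕ) := by
  rw [E2k, tsum_pnat_eq_tsum_succ
    (f := fun n : ℕ ↦ (ArithmeticFunction.sigma (2 * k - 1) n : ℂ) * cexp (2 * π * I * z) ^ n)]
  congr 2
  · push_cast; ring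
  · refine tsum_congr fun n ↦ ?_
    rw [← Complex.exp_nat_mul]
    congr 2
    push_cast
    ring

theorem E2k_eq_E {k : ℕ} (hk : 3 ≤ 2 * k) (z : ℍ) : E2k k z = ModularForm.E hk z := by
  rw [EisensteinSeries.q_expansion_bernoulli hk (even_two_mul k), E2k_eq_tsum_pnat]
  rfl

theorem E2k_one (z : ℍ) : E2k 1 z = EisensteinSeries.E2 z := by
  rw [EisensteinSeries.E2_eq_tsum_cexp, E2k_eq_tsum_pnat]
  norm_num [bernoulli_two]

theorem differentiableAt_E2k {k : ℕ} (hk : 1 ≤ k) {z : ℂ} (hz : 0 < z.im) :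
    DifferentiableAt ℂ (E2k k) z := by
  obtain ⟨f, hf, hfE⟩ : ∃ f : ℍ → ℂ, MDiff f ∧ ∀ w, f w = E2k k w := by
    rcases hk.eq_or_lt with rfl | hk
    · exact ⟨_, E2_mdifferentiable, fun w ↦ (E2k_one w).symm⟩
    · exact ⟨_, (ModularForm.E (by omega : 3 ≤ 2 * k)).holo', fun w ↦ (E2k_eq_E _ w).symm⟩
  have hnhds := isOpen_upperHalfPlaneSet.mem_nhds hz
  refine ((UpperHalfPlane.mdifferentiable_iff.1 hf).differentiableAt hnhds).congr_of_eventuallyEq ?_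
  filter_upwards [hnhds] with w hw
  rw [Function.comp_apply, hfE, ofComplex_apply_of_im_pos hw]

theorem tendsto_E2k {k : ℕ} (hk : 1 ≤ k) : Tendsto (E2k k) (comap Complex.im atTop) (𝓝 1) := by
  have hs := (EisensteinSeries.summable_sigma_mul_cexp_pow (k := 2 * k) (by omega)
    UpperHalfPlane.I).comp_injective (add_left_injective 1)
  have h := tendsto_tsum_cexp
    (c := fun n : ℕ ↦ (ArithmeticFunction.sigma (2 * k - 1) (n + 1) : ℂ))
    (x := fun n : ℕ ↦ (n : ℝ) + 1) (fun m ↦ by positivity) (hs.congr fun n ↦ by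
      rw [Function.comp_apply, ← Complex.exp_nat_mul]
      congr 2
      push_cast
      ring)
  have h2 := (h.const_mul (4 * k / (bernoulli (2 * k) : ℂ))).const_sub 1
  rw [mul_zero, sub_zero] at h2
  refine h2.congr fun z ↦ ?_
  rw [E2k]
  congr 2
  refine tsum_congr fun n ↦ ?_
  congr 2
  push_cast
  ring

/-- The Eisenstein series of weight `2k`, corrected to be modular (but not holomorphic) for
`k = 1`. -/
noncomputable def modularE2k (k : ℕ) (z : ℂ) : ℂ := E2k k z - if k = 1 then 3 / (π * z.im : ℂ) else 0

theorem tendsto_modularE2k {k : ℕ} (hk : 1 ≤ k) :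
    Tendsto (modularE2k k) (comap Complex.im atTop) (𝓝 1) := by
  unfold modularE2k
  rw [← sub_zero (1 : ℂ)]
  refine (tendsto_E2k hk).sub ?_
  split_ifs
  · have h : Tendsto (fun z : ℂ ↦ 3 / (π * z.im)) (comap Complex.im atTop) (𝓝 0) :=
      tendsto_const_nhds.div_atTop (tendsto_comap.const_mul_atTop Real.pi_pos)
    exact_mod_cast (continuous_ofReal.tendsto 0).comp h
  · exact tendsto_const_nhds

theorem modularE2k_smul {k : ℕ} (hk : 1 ≤ k) (γ : SL(2, ℤ)) (z : ℍ) :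
    modularE2k k (γ • z : ℍ) = denom γ z ^ (2 * k) * modularE2k k z := by
  have hden : denom γ z ≠ 0 := denom_ne_zero _ _
  unfold modularE2k
  rcases hk.eq_or_lt with rfl | hk
  · have h := congrFun (EisensteinSeries.E2_slash_action γ) z
    rw [ModularForm.SL_slash_apply] at h
    have hE : E2k 1 (γ • z : ℍ) = denom γ z ^ 2 * E2k 1 z - 6 * I * γ 1 0 * denom γ z / π := by
      simp only [Pi.sub_apply, Pi.smul_apply, EisensteinSeries.D2, riemannZeta_two, smul_eq_mul,
        zpow_neg] at h
      rw [E2k_one, E2k_one]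
      have hpi : (π : ℂ) ≠ 0 := by exact_mod_cast Real.pi_ne_zero
      have h2 : ((2 : ℤ)) = ((2 : ℕ) : ℤ) := rfl
      rw [h2, zpow_natCast] at h
      field_simp at h ⊢
      linear_combination h
    have hconj : (Complex.normSq (denom γ z) : ℂ) = denom γ z * (denom γ z - 2 * I * γ 1 0 * z.im) := by
      rw [Complex.normSq_eq_conj_mul_self, mul_comm, ModularGroup.denom_apply]
      congr 1
      apply Complex.ext <;> simp
      ring
    have him : ((γ • z : ℍ).im : ℂ) = z.im / Complex.normSq (denom γ z) := by
      rw [ModularGroup.im_smul_eq_div_normSq]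
      push_cast
      rfl
    have hy : (z.im : ℂ) ≠ 0 := by exact_mod_cast z.im_pos.ne'
    have hpi : (π : ℂ) ≠ 0 := by exact_mod_cast Real.pi_ne_zero
    simp only [if_true, coe_im]
    rw [hE, him, ← mul_div_assoc, div_div_eq_mul_div, hconj]
    field_simp
    ring
  · have h := SlashInvariantForm.slash_action_eqn'' (ModularForm.E (by omega : 3 ≤ 2 * k))
      (γ := Matrix.SpecialLinearGroup.mapGL ℝ γ) (MonoidHom.mem_range.2 ⟨γ, rfl⟩) z
    simp only [show k ≠ 1 by omega, if_false, sub_zero]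
    rw [E2k_eq_E (by omega), E2k_eq_E (by omega)]
    exact_mod_cast h

/-! ### Rescaling the argument -/

theorem smul_of_upper_triangular {γ γ' : SL(2, ℤ)} {d g e : ℕ} {β : ℤ} (hg : 0 < g) (he : 0 < e)
    (h00 : d * γ 0 0 = γ' 0 0 * g) (h01 : d * γ 0 1 = γ' 0 0 * β + γ' 0 1 * e)
    (h10 : γ 1 0 = γ' 1 0 * g) (h11 : γ 1 1 = γ' 1 0 * β + γ' 1 1 * e) (z : ℍ) :
    ∃ w : ℍ, (w : ℂ) = (g * z + β) / e ∧ d * ((γ • z : ℍ) : ℂ) = (γ' • w : ℍ) ∧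
      denom γ z = denom γ' w * e := by
  have he' : (e : ℂ) ≠ 0 := by exact_mod_cast he.ne'
  have him : 0 < (((g : ℂ) * z + β) / e).im := by
    have hz := z.im_pos
    have : (((g : ℂ) * z + β) / e).im = g * z.im / e := by simp [Complex.div_natCast_im]
    rw [this]
    positivity
  obtain ⟨w, hw⟩ : ∃ w : ℍ, (w : ℂ) = (g * z + β) / e := ⟨⟨_, him⟩, rfl⟩
  have hden : denom γ z = denom γ' w * e := by
    rw [ModularGroup.denom_apply, ModularGroup.denom_apply, h10, h11, hw]
    push_cast
    field_simp
    ring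
  refine ⟨w, hw, ?_, hden⟩
  have h1 : denom γ z ≠ 0 := denom_ne_zero _ _
  have h2 : denom γ' w ≠ 0 := denom_ne_zero _ _
  rw [coe_specialLinearGroup_apply, coe_specialLinearGroup_apply]
  simp only [algebraMap_int_eq, eq_intCast, ofReal_intCast]
  rw [← ModularGroup.denom_apply, ← ModularGroup.denom_apply, hden]
  have h00' : (d : ℂ) * γ 0 0 = γ' 0 0 * g := by exact_mod_cast h00
  have h01' : (d : ℂ) * γ 0 1 = γ' 0 0 * β + γ' 0 1 * e := by exact_mod_cast h01
  clear hden h1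
  generalize denom γ' w = D at h2 ⊢
  rw [hw]
  field_simp
  linear_combination h01' + h00' * (z : ℂ)

/-- `e = d / gcd(d, c)` and `c' = c / gcd(d, c)`. -/
def IsGcdReduced (d e : ℕ) (c c' : ℤ) : Prop :=
  ∃ g : ℕ, 0 < g ∧ 0 < e ∧ d = g * e ∧ c = g * c' ∧ IsCoprime (e : ℤ) c'

theorem tendsto_mul_add_div {g e : ℕ} (hg : 0 < g) (he : 0 < e) (β : ℤ) :
    Tendsto (fun z : ℍ ↦ ((g : ℂ) * z + β) / e) atImInfty (comap Complex.im atTop) := by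
  rw [tendsto_comap_iff]
  have h : Tendsto (fun z : ℍ ↦ (g / e : ℝ) * z.im) atImInfty atTop :=
    tendsto_comap.const_mul_atTop (by positivity)
  refine h.congr fun z ↦ ?_
  simp [Complex.div_natCast_im]
  ring

theorem IsGcdReduced.exists_smul {d e : ℕ} {c' : ℤ} {γ : SL(2, ℤ)} (h : IsGcdReduced d e (γ 1 0) c') :
    ∃ (γ' : SL(2, ℤ)) (w : ℍ → ℍ), γ' 0 0 = e * γ 0 0 ∧ γ' 1 0 = c' ∧
      Tendsto (fun z ↦ (w z : ℂ)) atImInfty (comap Complex.im atTop) ∧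
      ∀ z, d * ((γ • z : ℍ) : ℂ) = (γ' • w z : ℍ) ∧ denom γ z = denom γ' (w z) * e := by
  obtain ⟨g, hg, he, hd, hc, hco⟩ := h
  have hdet : γ 0 0 * γ 1 1 - γ 0 1 * γ 1 0 = 1 := by
    rw [← Matrix.det_fin_two, γ.det_coe]
  have hco2 : IsCoprime (e * γ 0 0) c' :=
    hco.mul_left ⟨γ 1 1, -γ 0 1 * g, by rw [hc] at hdet; linear_combination hdet⟩
  obtain ⟨y, x, hxy⟩ := hco2
  let γ' : SL(2, ℤ) := ⟨!![e * γ 0 0, -x; c', y], by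
    rw [Matrix.det_fin_two_of]; linear_combination hxy⟩
  have h00 : γ' 0 0 = e * γ 0 0 := rfl
  have h01 : γ' 0 1 = -x := rfl
  have h10 : γ' 1 0 = c' := rfl
  have h11 : γ' 1 1 = y := rfl
  have hd' : (d : ℤ) = g * e := by exact_mod_cast hd
  choose w hw hw' using smul_of_upper_triangular (γ := γ) (γ' := γ') (d := d)
    (β := y * d * γ 0 1 + x * γ 1 1) hg he (by rw [h00, hd']; ring)
    (by
      rw [h00, h01]
      rw [hc] at hdet
      linear_combination (-d * γ 0 1) * hxy + (-x * e) * hdet + (γ 0 1 * x * c') * hd')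
    (by rw [h10, hc]; ring)
    (by
      rw [h10, h11]
      rw [hc] at hdet
      linear_combination (-γ 1 1) * hxy + (y * e) * hdet + (-c' * y * γ 0 1) * hd')
  refine ⟨γ', w, h00, h10, ?_, hw'⟩
  simp only [hw]
  exact tendsto_mul_add_div hg he _

theorem IsGcdReduced.tendsto_modularE2k {d e k : ℕ} (hk : 1 ≤ k) {c' : ℤ} {γ : SL(2, ℤ)}
    (h : IsGcdReduced d e (γ 1 0) c') :
    Tendsto (fun z : ℍ ↦ modularE2k k (d * (γ • z : ℍ)) / denom γ z ^ (2 * k)) atImInfty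
      (𝓝 (1 / e ^ (2 * k))) := by
  have he : (e : ℂ) ≠ 0 := by
    obtain ⟨g, _, he, _⟩ := h
    exact_mod_cast he.ne'
  obtain ⟨γ', w, _, _, hlim, hw⟩ := h.exists_smul
  refine (((_root_.tendsto_modularE2k hk).comp hlim).div_const ((e : ℂ) ^ (2 * k))).congr fun z ↦ ?_
  have h2 : denom γ' (w z) ≠ 0 := denom_ne_zero _ _
  rw [(hw z).1, (hw z).2, modularE2k_smul hk, Function.comp_apply, mul_pow]
  field_simp

theorem IsGcdReduced.tendsto_Psi_sq {d e : ℕ} {c' : ℤ} {γ : SL(2, ℤ)}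
    (h : IsGcdReduced d e (γ 1 0) c') :
    Tendsto (fun z : ℍ ↦ 4 * Psi (d * (γ • z : ℍ)) ^ 2 / denom γ z) atImInfty
      (𝓝 ((if Even c' then 0 else I ^ (c' * (e * γ 0 0 + 1) + 2)) / e)) := by
  have he : (e : ℂ) ≠ 0 := by
    obtain ⟨g, _, he, _⟩ := h
    exact_mod_cast he.ne'
  obtain ⟨γ', w, h00, h10, hlim, hw⟩ := h.exists_smul
  have key := (((tendsto_thetaSq (r := γ' 1 0) (s := γ' 1 1)).comp hlim).const_mul
    (I ^ thetaExponent (γ' 0 0) (γ' 0 1) (γ' 1 0) (γ' 1 1))).div_const (e : ℂ)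
  have hval : I ^ thetaExponent (γ' 0 0) (γ' 0 1) (γ' 1 0) (γ' 1 1) *
      (if Even (γ' 1 0) then 0 else 1) =
      if Even c' then 0 else I ^ (c' * (e * γ 0 0 + 1) + 2) := by
    rw [thetaExponent, h00, h10]
    split_ifs <;> simp
  rw [hval] at key
  refine key.congr fun z ↦ ?_
  have h2 : denom γ' (w z) ≠ 0 := denom_ne_zero _ _
  rw [(hw z).1, (hw z).2, theta_smul, Function.comp_apply]
  field_simp

/-! ### The difference of the theta product and the Eisenstein part -/

/-- The linear combination of Eisenstein series attached to `Ψ₈(z)^(2α) Ψ₈(3z)^(2β)`, as a function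
of the values `x_d = E_{2k}(d z)`. -/
noncomputable def eisComb (α β k : ℕ) (x₄ x₁₂ x₈ x₂₄ x₁₆ x₄₈ : ℂ) : ℂ :=
  (((-1 : ℂ) ^ (k + β) - 1) / (2 ^ (4 * k) * (2 ^ (2 * k) - 1) * (3 ^ (2 * k) - 1))) *
      (((-3 : ℂ) ^ α - 1) * x₄ + ((3 : ℂ) ^ (2 * k) - (-3 : ℂ) ^ α) * x₁₂) +
    (((2 : ℂ) ^ (2 * k) + 1 - (-1 : ℂ) ^ (k + β)) /
        (2 ^ (4 * k) * (2 ^ (2 * k) - 1) * (3 ^ (2 * k) - 1))) *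
      (((-3 : ℂ) ^ α - 1) * x₈ + ((3 : ℂ) ^ (2 * k) - (-3 : ℂ) ^ α) * x₂₄) +
    (-(2 : ℂ) ^ (2 * k) / (2 ^ (4 * k) * (2 ^ (2 * k) - 1) * (3 ^ (2 * k) - 1))) *
      (((-3 : ℂ) ^ α - 1) * x₁₆ + ((3 : ℂ) ^ (2 * k) - (-3 : ℂ) ^ α) * x₄₈)

/-- The difference between `Ψ₈(z)^(2α) Ψ₈(3z)^(2β)` and its Eisenstein part. -/
noncomputable def cuspPart (α β k : ℕ) (z : ℂ) : ℂ :=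
  Psi (8 * z) ^ (2 * α) * Psi (24 * z) ^ (2 * β) -
    eisComb α β k (E2k k (4 * z)) (E2k k (12 * z)) (E2k k (8 * z)) (E2k k (24 * z))
      (E2k k (16 * z)) (E2k k (48 * z))

theorem cuspPart_eq {α β k : ℕ} (hk : 1 ≤ k) (h : α + β = 2 * k) (z : ℍ) :
    cuspPart α β k z = (4 * Psi (8 * z) ^ 2) ^ α * (4 * Psi (24 * z) ^ 2) ^ β / 2 ^ (4 * k) -
      eisComb α β k (modularE2k k (4 * z)) (modularE2k k (12 * z)) (modularE2k k (8 * z))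
        (modularE2k k (24 * z)) (modularE2k k (16 * z)) (modularE2k k (48 * z)) := by
  unfold cuspPart
  congr 1
  · have h4 : (2 : ℂ) ^ (4 * k) = 4 ^ α * 4 ^ β := by
      rw [← pow_add, h, show (4 : ℂ) = 2 ^ 2 by norm_num, ← pow_mul]
      ring_nf
    rw [h4, mul_pow, mul_pow, pow_mul, pow_mul]
    field_simp
  · unfold modularE2k
    by_cases hk1 : k = 1
    · subst hk1
      have hy : (z.im : ℂ) ≠ 0 := by exact_mod_cast z.im_pos.ne'
      have hpi : (π : ℂ) ≠ 0 := by exact_mod_cast Real.pi_ne_zero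
      have him (d : ℝ) : (((d : ℂ) * z).im : ℂ) = d * z.im := by simp
      have h4 := him 4
      have h12 := him 12
      have h8 := him 8
      have h24 := him 24
      have h16 := him 16
      have h48 := him 48
      push_cast at h4 h12 h8 h24 h16 h48
      simp only [h4, h12, h8, h24, h16, h48, if_true]
      have hα : α ≤ 2 := by omega
      obtain rfl : β = 2 - α := by omega
      interval_cases α <;> simp only [eisComb] <;> norm_num <;> field_simp <;> ring
    · simp [hk1]

theorem eisComb_mul (α β k : ℕ) (r x₄ x₁₂ x₈ x₂₄ x₁₆ x₄₈ : ℂ) :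
    eisComb α β k (r * x₄) (r * x₁₂) (r * x₈) (r * x₂₄) (r * x₁₆) (r * x₄₈) =
      r * eisComb α β k x₄ x₁₂ x₈ x₂₄ x₁₆ x₄₈ := by
  unfold eisComb
  ring

theorem exists_smul_of_dvd {d : ℕ} (hd : 0 < d) {γ : SL(2, ℤ)} (h : (d : ℤ) ∣ γ 1 0) :
    ∃ γ' : SL(2, ℤ), γ' 0 1 = d * γ 0 1 ∧ γ 1 0 = d * γ' 1 0 ∧ γ' 1 1 = γ 1 1 ∧ ∀ z : ℍ, ∃ w : ℍ,
      (w : ℂ) = d * z ∧ d * ((γ • z : ℍ) : ℂ) = (γ' • w : ℍ) ∧ denom γ z = denom γ' w := by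
  obtain ⟨c, hc⟩ := h
  have hdet : γ 0 0 * γ 1 1 - γ 0 1 * γ 1 0 = 1 := by
    rw [← Matrix.det_fin_two, γ.det_coe]
  let γ' : SL(2, ℤ) := ⟨!![γ 0 0, d * γ 0 1; c, γ 1 1], by
    rw [Matrix.det_fin_two_of]; rw [hc] at hdet; linear_combination hdet⟩
  have h00 : γ' 0 0 = γ 0 0 := rfl
  have h01 : γ' 0 1 = d * γ 0 1 := rfl
  have h10 : γ' 1 0 = c := rfl
  have h11 : γ' 1 1 = γ 1 1 := rfl
  refine ⟨γ', h01, hc.trans (by rw [h10]), h11, fun z ↦ ?_⟩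
  obtain ⟨w, hw, h1, h2⟩ := smul_of_upper_triangular (γ := γ) (γ' := γ') (d := d) (e := 1)
    (β := 0) hd one_pos (by rw [h00]; ring) (by rw [h01]; push_cast; ring)
    (by rw [h10, hc]; ring) (by rw [h11]; push_cast; ring) z
  exact ⟨w, by simpa using hw, h1, by simpa using h2⟩

theorem modularE2k_mul_smul {d k : ℕ} (hd : 0 < d) (hk : 1 ≤ k) {γ : SL(2, ℤ)}
    (h : (d : ℤ) ∣ γ 1 0) (z : ℍ) :
    modularE2k k (d * (γ • z : ℍ)) = denom γ z ^ (2 * k) * modularE2k k (d * z) := by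
  obtain ⟨γ', _, _, _, hγ'⟩ := exists_smul_of_dvd hd h
  obtain ⟨w, hw, h1, h2⟩ := hγ' z
  rw [h1, h2, modularE2k_smul hk, hw]

theorem Psi_mul_smul {d : ℕ} (hd : 0 < d) (hd4 : 4 ∣ d) {γ : SL(2, ℤ)} (h : (2 * d : ℤ) ∣ γ 1 0)
    (z : ℍ) : 4 * Psi (d * (γ • z : ℍ)) ^ 2 =
      denom γ z * (I ^ (γ 1 1 - 1) * (4 * Psi (d * z) ^ 2)) := by
  obtain ⟨γ', h01, h10, h11, hγ'⟩ := exists_smul_of_dvd hd (dvd_of_mul_left_dvd h)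
  obtain ⟨w, hw, h1, h2⟩ := hγ' z
  have heven : Even (γ' 1 0) := by
    obtain ⟨j, hj⟩ := h
    refine ⟨j, ?_⟩
    have hd' : (d : ℤ) ≠ 0 := by exact_mod_cast hd.ne'
    apply mul_left_cancel₀ hd'
    linarith
  have hexp : I ^ thetaExponent (γ' 0 0) (γ' 0 1) (γ' 1 0) (γ' 1 1) = I ^ (γ 1 1 - 1) := by
    rw [thetaExponent, if_pos heven, h11, h01]
    obtain ⟨j, rfl⟩ := hd4
    apply I_zpow_eq_of_zmod
    have h4 : (4 : ZMod 4) = 0 := by decide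
    push_cast
    rw [h4]
    ring
  rw [h1, h2, theta_smul, hexp, thetaSq, if_pos heven, hw]

theorem I_zpow_two_mul_of_even {n : ℤ} (hn : Even n) (k : ℤ) : (I ^ n) ^ (2 * k) = 1 := by
  obtain ⟨j, rfl⟩ := hn
  rw [← zpow_mul, show (j + j) * (2 * k) = ((4 : ℕ) : ℤ) * (j * k) by push_cast; ring, zpow_mul,
    zpow_natCast, I_pow_four, one_zpow]

theorem cuspPart_smul {α β k : ℕ} (hk : 1 ≤ k) (hαβ : α + β = 2 * k) {γ : SL(2, ℤ)}
    (hγ : 48 ∣ γ 1 0) (z : ℍ) :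
    cuspPart α β k (γ • z : ℍ) = denom γ z ^ (2 * k) * cuspPart α β k z := by
  have hE (d : ℕ) (hd : d ∣ 48) := modularE2k_mul_smul (d := d) (Nat.pos_of_dvd_of_pos hd (by simp))
    hk ((Int.natCast_dvd_natCast.2 hd).trans hγ) z
  have h4 := hE 4 (by norm_num)
  have h12 := hE 12 (by norm_num)
  have h8 := hE 8 (by norm_num)
  have h24 := hE 24 (by norm_num)
  have h16 := hE 16 (by norm_num)
  have h48 := hE 48 (by norm_num)
  have hP8 := Psi_mul_smul (d := 8) (by simp) (by norm_num)
    ((show (2 * (8 : ℕ) : ℤ) ∣ 48 by norm_num).trans hγ) z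
  have hP24 := Psi_mul_smul (d := 24) (by simp) (by norm_num)
    ((show (2 * (24 : ℕ) : ℤ) ∣ 48 by norm_num).trans hγ) z
  simp only [Nat.cast_ofNat] at h4 h12 h8 h24 h16 h48 hP8 hP24
  have hodd : Even (γ 1 1 - 1) := by
    have hdet : γ 0 0 * γ 1 1 - γ 0 1 * γ 1 0 = 1 := by
      rw [← Matrix.det_fin_two, γ.det_coe]
    obtain ⟨c, hc⟩ := hγ
    have : Odd (γ 0 0 * γ 1 1) := ⟨24 * c * γ 0 1, by rw [hc] at hdet; linarith⟩
    exact (Int.odd_mul.1 this).2.sub_odd odd_one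
  have hone : (I ^ (γ 1 1 - 1)) ^ α * (I ^ (γ 1 1 - 1)) ^ β = 1 := by
    rw [← pow_add, hαβ]
    exact_mod_cast I_zpow_two_mul_of_even hodd k
  rw [cuspPart_eq hk hαβ, cuspPart_eq hk hαβ, h4, h12, h8, h24, h16, h48, hP8, hP24, eisComb_mul,
    mul_sub]
  congr 1
  rw [← hαβ, pow_add]
  simp only [mul_pow _ _ α, mul_pow _ _ β]
  linear_combination (denom γ z ^ α * denom γ z ^ β * (4 ^ α * (Psi (8 * z) ^ 2) ^ α) *
    (4 ^ β * (Psi (24 * z) ^ 2) ^ β) / 2 ^ (4 * k)) * hone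

theorem differentiableAt_cuspPart {α β k : ℕ} (hk : 1 ≤ k) {z : ℂ} (hz : 0 < z.im) :
    DifferentiableAt ℂ (cuspPart α β k) z := by
  have hpos (d : ℝ) (hd : 0 < d) : 0 < ((d : ℂ) * z).im := by
    rw [Complex.im_ofReal_mul]; positivity
  have hE (d : ℝ) (hd : 0 < d) : DifferentiableAt ℂ (fun z ↦ E2k k (d * z)) z :=
    (differentiableAt_E2k hk (hpos d hd)).comp z (f := fun z ↦ (d : ℂ) * z) (by fun_prop)
  have hP (d : ℝ) (hd : 0 < d) : DifferentiableAt ℂ (fun z ↦ Psi (d * z)) z :=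
    (differentiableAt_Psi (hpos d hd)).comp z (f := fun z ↦ (d : ℂ) * z) (by fun_prop)
  have h4 := hE 4 (by simp)
  have h12 := hE 12 (by simp)
  have h8 := hE 8 (by simp)
  have h24 := hE 24 (by simp)
  have h16 := hE 16 (by simp)
  have h48 := hE 48 (by simp)
  have hP8 := hP 8 (by simp)
  have hP24 := hP 24 (by simp)
  simp only [ofReal_ofNat] at h4 h12 h8 h24 h16 h48 hP8 hP24
  unfold cuspPart eisComb
  fun_prop

/-! ### Vanishing at the cusps -/

theorem tendsto_eisComb {ι : Type*} {l : Filter ι} (α β k : ℕ) {f₄ f₁₂ f₈ f₂₄ f₁₆ f₄₈ : ι → ℂ}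
    {x₄ x₁₂ x₈ x₂₄ x₁₆ x₄₈ : ℂ} (h₄ : Tendsto f₄ l (𝓝 x₄)) (h₁₂ : Tendsto f₁₂ l (𝓝 x₁₂))
    (h₈ : Tendsto f₈ l (𝓝 x₈)) (h₂₄ : Tendsto f₂₄ l (𝓝 x₂₄)) (h₁₆ : Tendsto f₁₆ l (𝓝 x₁₆))
    (h₄₈ : Tendsto f₄₈ l (𝓝 x₄₈)) :
    Tendsto (fun i ↦ eisComb α β k (f₄ i) (f₁₂ i) (f₈ i) (f₂₄ i) (f₁₆ i) (f₄₈ i)) l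
      (𝓝 (eisComb α β k x₄ x₁₂ x₈ x₂₄ x₁₆ x₄₈)) := by
  have key {f g : ι → ℂ} {x y : ℂ} (hf : Tendsto f l (𝓝 x)) (hg : Tendsto g l (𝓝 y)) (r s t : ℂ) :
      Tendsto (fun i ↦ r * (s * f i + t * g i)) l (𝓝 (r * (s * x + t * y))) :=
    ((hf.const_mul s).add (hg.const_mul t)).const_mul r
  exact ((key h₄ h₁₂ _ _ _).add (key h₈ h₂₄ _ _ _)).add (key h₁₆ h₄₈ _ _ _)

theorem tendsto_cuspPart_div {α β k : ℕ} (hk : 1 ≤ k) (hαβ : α + β = 2 * k) {γ : SL(2, ℤ)}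
    {e₄ e₁₂ e₈ e₂₄ e₁₆ e₄₈ : ℕ} {c₄ c₁₂ c₈ c₂₄ c₁₆ c₄₈ : ℤ}
    (h₄ : IsGcdReduced 4 e₄ (γ 1 0) c₄) (h₁₂ : IsGcdReduced 12 e₁₂ (γ 1 0) c₁₂)
    (h₈ : IsGcdReduced 8 e₈ (γ 1 0) c₈) (h₂₄ : IsGcdReduced 24 e₂₄ (γ 1 0) c₂₄)
    (h₁₆ : IsGcdReduced 16 e₁₆ (γ 1 0) c₁₆) (h₄₈ : IsGcdReduced 48 e₄₈ (γ 1 0) c₄₈) :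
    Tendsto (fun z : ℍ ↦ cuspPart α β k (γ • z : ℍ) / denom γ z ^ (2 * k)) atImInfty
      (𝓝 (((if Even c₈ then 0 else I ^ (c₈ * (e₈ * γ 0 0 + 1) + 2)) / e₈) ^ α *
        ((if Even c₂₄ then 0 else I ^ (c₂₄ * (e₂₄ * γ 0 0 + 1) + 2)) / e₂₄) ^ β / 2 ^ (4 * k) -
        eisComb α β k (1 / e₄ ^ (2 * k)) (1 / e₁₂ ^ (2 * k)) (1 / e₈ ^ (2 * k))
          (1 / e₂₄ ^ (2 * k)) (1 / e₁₆ ^ (2 * k)) (1 / e₄₈ ^ (2 * k)))) := by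
  refine (((((h₈.tendsto_Psi_sq).pow α).mul ((h₂₄.tendsto_Psi_sq).pow β)).div_const
    ((2 : ℂ) ^ (4 * k))).sub (tendsto_eisComb α β k (h₄.tendsto_modularE2k hk)
    (h₁₂.tendsto_modularE2k hk) (h₈.tendsto_modularE2k hk) (h₂₄.tendsto_modularE2k hk)
    (h₁₆.tendsto_modularE2k hk) (h₄₈.tendsto_modularE2k hk))).congr fun z ↦ ?_
  have hden : denom γ z ≠ 0 := denom_ne_zero _ _
  simp only [Nat.cast_ofNat]
  rw [cuspPart_eq hk hαβ, sub_div, div_eq_inv_mul (eisComb ..), ← eisComb_mul]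
  congr 1
  · rw [← hαβ, pow_add, div_pow, div_pow]
    field_simp
  · simp only [div_eq_inv_mul]

theorem isGcdReduced_cases (c : ℤ) :
    (∃ (e : ℕ) (c₄ c₈ c₁₆ : ℤ), IsGcdReduced 4 e c c₄ ∧ IsGcdReduced 8 (2 * e) c c₈ ∧
      IsGcdReduced 16 (4 * e) c c₁₆ ∧ Odd c₈) ∨
    (∃ c₄ c₈ c₁₆ : ℤ, IsGcdReduced 4 1 c c₄ ∧ IsGcdReduced 8 1 c c₈ ∧
      IsGcdReduced 16 2 c c₁₆ ∧ Odd c₈) ∨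
    ∃ c₄ c₈ c₁₆ : ℤ, IsGcdReduced 4 1 c c₄ ∧ IsGcdReduced 8 1 c c₈ ∧
      IsGcdReduced 16 1 c c₁₆ ∧ Even c₈ := by
  have hred (g n : ℕ) (hg : 0 < g) {c c' : ℤ} (h : Odd c') (hc : c = g * c') :
      IsGcdReduced (g * 2 ^ n) (2 ^ n) c c' := by
    refine ⟨g, hg, by positivity, rfl, hc, ?_⟩
    push_cast
    exact (Int.isCoprime_two_left.2 h).pow_left
  have hred_one (g : ℕ) (hg : 0 < g) {c c' : ℤ} (hc : c = g * c') : IsGcdReduced g 1 c c' :=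
    ⟨g, hg, one_pos, (mul_one g).symm, hc, by rw [Nat.cast_one]; exact isCoprime_one_left⟩
  rcases Int.even_or_odd' c with ⟨b, hc | hc⟩
  · rcases Int.even_or_odd' b with ⟨j, hb | hb⟩
    · rcases Int.even_or_odd' j with ⟨i, hj | hj⟩
      · rcases Int.even_or_odd' i with ⟨n, hi | hi⟩
        · exact .inr (.inr ⟨j, i, n, hred_one 4 (by simp) (by omega),
            hred_one 8 (by simp) (by omega), hred_one 16 (by simp) (by omega), n, by omega⟩)
        · have h : Odd i := ⟨n, hi⟩
          exact .inr (.inl ⟨j, i, i, hred_one 4 (by simp) (by omega),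
            hred_one 8 (by simp) (by omega), hred 8 1 (by simp) h (by omega), h⟩)
      · have h : Odd j := ⟨i, hj⟩
        exact .inl ⟨1, j, j, j, hred 4 0 (by simp) h (by omega), hred 4 1 (by simp) h (by omega),
          hred 4 2 (by simp) h (by omega), h⟩
    · have h : Odd b := ⟨j, hb⟩
      exact .inl ⟨2, b, b, b, hred 2 1 (by simp) h (by omega), hred 2 2 (by simp) h (by omega),
        hred 2 3 (by simp) h (by omega), h⟩
  · have h : Odd c := ⟨b, hc⟩
    exact .inl ⟨4, c, c, c, hred 1 2 (by simp) h (by omega), hred 1 3 (by simp) h (by omega),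
      hred 1 4 (by simp) h (by omega), h⟩

theorem IsGcdReduced.three_mul {d e : ℕ} {c c' : ℤ} (h : IsGcdReduced d e c c')
    (h3 : IsCoprime 3 c) : IsGcdReduced (3 * d) (3 * e) c c' := by
  obtain ⟨g, hg, he, hd, hc, hco⟩ := h
  refine ⟨g, hg, by positivity, by rw [hd]; ring, hc, ?_⟩
  push_cast
  exact (h3.of_isCoprime_of_dvd_right ⟨g, by rw [hc]; ring⟩).mul_left hco

theorem IsGcdReduced.three_mul_of_dvd {d e : ℕ} {c c' : ℤ} (h : IsGcdReduced d e c c')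
    (h3 : IsCoprime 3 (d : ℤ)) (h3c : 3 ∣ c) :
    ∃ c'', c' = 3 * c'' ∧ IsGcdReduced (3 * d) e c c'' := by
  obtain ⟨g, hg, he, hd, hc, hco⟩ := h
  have hg3 : IsCoprime 3 (g : ℤ) := h3.of_isCoprime_of_dvd_right ⟨e, by exact_mod_cast hd⟩
  obtain ⟨c'', rfl⟩ := hg3.dvd_of_dvd_mul_left (hc ▸ h3c)
  exact ⟨c'', rfl, 3 * g, by positivity, he, by rw [hd]; ring, by rw [hc]; push_cast; ring,
    hco.of_mul_right_right⟩

theorem I_zpow_add_two (n j : ℤ) : I ^ (n + 2 + 4 * j) = -I ^ n := by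
  rw [zpow_add₀ I_ne_zero, zpow_add₀ I_ne_zero, zpow_mul]
  norm_cast
  rw [I_pow_four]
  simp

theorem I_zpow_add_four_mul (n j : ℤ) : I ^ (n + 4 * j) = I ^ n := by
  rw [zpow_add₀ I_ne_zero, zpow_mul]
  norm_cast
  rw [I_pow_four]
  simp

theorem I_zpow_pow_two_mul_of_odd {n : ℤ} (hn : Odd n) (k : ℕ) : (I ^ n) ^ (2 * k) = (-1) ^ k := by
  obtain ⟨j, rfl⟩ := hn
  rw [pow_mul, ← zpow_natCast (I ^ (2 * j + 1)) 2, ← zpow_mul,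
    show (2 * j + 1) * ((2 : ℕ) : ℤ) = 0 + 2 + 4 * j by push_cast; ring, I_zpow_add_two, zpow_zero]

theorem I_zpow_pow_two_mul_of_even {n : ℤ} (hn : Even n) (k : ℕ) : (I ^ n) ^ (2 * k) = 1 := by
  exact_mod_cast I_zpow_two_mul_of_even hn k

theorem eisComb_mul_ratio (α β k : ℕ) (r x₄ x₈ x₁₆ : ℂ) :
    eisComb α β k x₄ (r * x₄) x₈ (r * x₈) x₁₆ (r * x₁₆) =
      ((-3) ^ α - 1 + (3 ^ (2 * k) - (-3) ^ α) * r) *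
        (((-1) ^ (k + β) - 1) * x₄ + (2 ^ (2 * k) + 1 - (-1) ^ (k + β)) * x₈ - 2 ^ (2 * k) * x₁₆) /
        (2 ^ (4 * k) * (2 ^ (2 * k) - 1) * (3 ^ (2 * k) - 1)) := by
  unfold eisComb
  ring

theorem ofNat_pow_two_mul_sub_one_ne_zero {k n : ℕ} (hk : 1 ≤ k) (hn : 1 < n) :
    (n : ℂ) ^ (2 * k) - 1 ≠ 0 := by
  rw [sub_ne_zero]
  exact_mod_cast (Nat.one_lt_pow (by omega) hn).ne'

theorem theta_limit_eq_of_dvd {α β k : ℕ} (hk : 1 ≤ k) (hαβ : α + β = 2 * k) {e₄ e₈ e₁₆ : ℕ}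
    {u₈ u₂₄ s : ℂ}
    (hs : ((-1) ^ (k + β) - 1) * (1 / (e₄ : ℂ) ^ (2 * k)) +
      (2 ^ (2 * k) + 1 - (-1) ^ (k + β)) * (1 / (e₈ : ℂ) ^ (2 * k)) -
      2 ^ (2 * k) * (1 / (e₁₆ : ℂ) ^ (2 * k)) = (2 ^ (2 * k) - 1) * (s / e₈ ^ (2 * k)))
    (hu : u₈ ^ α * u₂₄ ^ β = s) :
    (u₈ / e₈) ^ α * (u₂₄ / e₈) ^ β / 2 ^ (4 * k) =
      eisComb α β k (1 / e₄ ^ (2 * k)) (1 / e₄ ^ (2 * k)) (1 / e₈ ^ (2 * k)) (1 / e₈ ^ (2 * k))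
        (1 / e₁₆ ^ (2 * k)) (1 / e₁₆ ^ (2 * k)) := by
  have h := eisComb_mul_ratio α β k 1 (1 / e₄ ^ (2 * k)) (1 / e₈ ^ (2 * k)) (1 / e₁₆ ^ (2 * k))
  simp only [one_mul] at h
  have h2 := ofNat_pow_two_mul_sub_one_ne_zero (n := 2) hk (by simp)
  have h3 := ofNat_pow_two_mul_sub_one_ne_zero (n := 3) hk (by simp)
  rw [Nat.cast_ofNat] at h2 h3
  rw [h, hs, div_pow, div_pow, div_mul_div_comm, hu, ← pow_add, hαβ]
  field_simp
  ring

theorem theta_limit_eq_of_isCoprime {α β k : ℕ} (hk : 1 ≤ k) (hαβ : α + β = 2 * k) {e₄ e₈ e₁₆ : ℕ}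
    {u₈ u₂₄ s : ℂ}
    (hs : ((-1) ^ (k + β) - 1) * (1 / (e₄ : ℂ) ^ (2 * k)) +
      (2 ^ (2 * k) + 1 - (-1) ^ (k + β)) * (1 / (e₈ : ℂ) ^ (2 * k)) -
      2 ^ (2 * k) * (1 / (e₁₆ : ℂ) ^ (2 * k)) = (2 ^ (2 * k) - 1) * (s / e₈ ^ (2 * k)))
    (hu : u₈ ^ α * u₂₄ ^ β = s * (-1) ^ α) :
    (u₈ / e₈) ^ α * (u₂₄ / (3 * e₈ : ℕ)) ^ β / 2 ^ (4 * k) =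
      eisComb α β k (1 / e₄ ^ (2 * k)) (1 / (3 * e₄ : ℕ) ^ (2 * k)) (1 / e₈ ^ (2 * k))
        (1 / (3 * e₈ : ℕ) ^ (2 * k)) (1 / e₁₆ ^ (2 * k)) (1 / (3 * e₁₆ : ℕ) ^ (2 * k)) := by
  have h := eisComb_mul_ratio α β k (1 / 3 ^ (2 * k)) (1 / e₄ ^ (2 * k)) (1 / e₈ ^ (2 * k))
    (1 / e₁₆ ^ (2 * k))
  have hx (e : ℕ) : 1 / ((3 * e : ℕ) : ℂ) ^ (2 * k) = 1 / 3 ^ (2 * k) * (1 / e ^ (2 * k)) := by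
    rw [Nat.cast_mul, mul_pow, one_div_mul_one_div, Nat.cast_ofNat]
  have h2 := ofNat_pow_two_mul_sub_one_ne_zero (n := 2) hk (by simp)
  have h3 := ofNat_pow_two_mul_sub_one_ne_zero (n := 3) hk (by simp)
  rw [Nat.cast_ofNat] at h2 h3
  have hr : (-3 : ℂ) ^ α - 1 + (3 ^ (2 * k) - (-3) ^ α) * (1 / 3 ^ (2 * k)) =
      (3 ^ (2 * k) - 1) * ((-1) ^ α / 3 ^ β) := by
    rw [← hαβ, pow_add, neg_pow]
    field_simp
    ring
  rw [hx, hx, hx, h, hs, hr, Nat.cast_mul, div_pow, div_pow, div_mul_div_comm, hu, mul_pow,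
    mul_left_comm, ← pow_add, hαβ, Nat.cast_ofNat]
  field_simp

/-- The limits of the theta product and of the Eisenstein part agree at every cusp. -/
theorem tendsto_cuspPart_div_zero {α β k : ℕ} (hk : 1 ≤ k) (hαβ : α + β = 2 * k) (γ : SL(2, ℤ)) :
    Tendsto (fun z : ℍ ↦ cuspPart α β k (γ • z : ℍ) / denom γ z ^ (2 * k)) atImInfty (𝓝 0) := by
  have hdet : γ 0 0 * γ 1 1 - γ 0 1 * γ 1 0 = 1 := by
    rw [← Matrix.det_fin_two, γ.det_coe]
  have hodd {c : ℤ} (h : IsGcdReduced 8 1 (γ 1 0) c) : Odd (γ 0 0) := by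
    obtain ⟨g, _, _, hg, hc, _⟩ := h
    obtain rfl : g = 8 := by omega
    have : Odd (γ 0 0 * γ 1 1) := ⟨4 * c * γ 0 1, by rw [hc] at hdet; push_cast at hdet; linarith⟩
    exact (Int.odd_mul.1 this).1
  have hsign : (-1 : ℂ) ^ α = (-1) ^ β := neg_one_pow_congr (by grind)
  have hsign2 : (-1 : ℂ) ^ β * (-1) ^ β = 1 := by rw [← mul_pow]; simp
  -- the limits of the Eisenstein part and of the theta product away from the prime three
  suffices h : ∃ (e₄ e₈ e₁₆ : ℕ) (c₄ c₈ c₁₆ : ℤ) (s : ℂ), IsGcdReduced 4 e₄ (γ 1 0) c₄ ∧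
      IsGcdReduced 8 e₈ (γ 1 0) c₈ ∧ IsGcdReduced 16 e₁₆ (γ 1 0) c₁₆ ∧
      (((-1) ^ (k + β) - 1) * (1 / (e₄ : ℂ) ^ (2 * k)) +
        (2 ^ (2 * k) + 1 - (-1) ^ (k + β)) * (1 / (e₈ : ℂ) ^ (2 * k)) -
        2 ^ (2 * k) * (1 / (e₁₆ : ℂ) ^ (2 * k)) = (2 ^ (2 * k) - 1) * (s / e₈ ^ (2 * k))) ∧
      (Odd c₈ ∧ Even e₈ ∧ s = (-1) ^ (k + β) ∨ Odd c₈ ∧ Odd (e₈ * γ 0 0) ∧ s = 1 ∨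
        Even c₈ ∧ s = 0) by
    obtain ⟨e₄, e₈, e₁₆, c₄, c₈, c₁₆, s, h₄, h₈, h₁₆, hs, hcase⟩ := h
    by_cases h3 : (3 : ℤ) ∣ γ 1 0
    · obtain ⟨c₁₂, -, h₁₂⟩ := h₄.three_mul_of_dvd (by norm_num) h3
      obtain ⟨c₂₄, rfl, h₂₄⟩ := h₈.three_mul_of_dvd (by norm_num) h3
      obtain ⟨c₄₈, -, h₄₈⟩ := h₁₆.three_mul_of_dvd (by norm_num) h3
      have key := tendsto_cuspPart_div hk hαβ h₄ h₁₂ h₈ h₂₄ h₁₆ h₄₈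
      rwa [theta_limit_eq_of_dvd hk hαβ hs, sub_self] at key
      rcases hcase with ⟨hc, he, rfl⟩ | ⟨hc, he, rfl⟩ | ⟨hc, rfl⟩
      · have hc' : Odd c₂₄ := (Int.odd_mul.1 hc).2
        have hv : Odd (c₂₄ * (e₈ * γ 0 0 + 1)) :=
          hc'.mul ((((Int.even_coe_nat _).2 he).mul_right _).add_odd odd_one)
        rw [if_neg (Int.not_even_iff_odd.2 hc), if_neg (Int.not_even_iff_odd.2 hc')]
        obtain ⟨j, hj⟩ := id hv
        rw [show 3 * c₂₄ * (e₈ * γ 0 0 + 1) + 2 = (c₂₄ * (e₈ * γ 0 0 + 1) + 2) + 2 + 4 * j by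
          linear_combination 2 * hj, I_zpow_add_two, neg_pow, mul_assoc, ← pow_add, hαβ,
          I_zpow_pow_two_mul_of_odd (hv.add_even even_two), pow_add, hsign,
          mul_comm]
      · have hc' : Odd c₂₄ := (Int.odd_mul.1 hc).2
        have hv : Even (c₂₄ * (e₈ * γ 0 0 + 1)) := (he.add_odd odd_one).mul_left _
        rw [if_neg (Int.not_even_iff_odd.2 hc), if_neg (Int.not_even_iff_odd.2 hc')]
        obtain ⟨j, hj⟩ := id hv
        rw [show 3 * c₂₄ * (e₈ * γ 0 0 + 1) + 2 = (c₂₄ * (e₈ * γ 0 0 + 1) + 2) + 4 * j by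
          linear_combination 2 * hj, I_zpow_add_four_mul, ← pow_add, hαβ,
          I_zpow_pow_two_mul_of_even (hv.add even_two)]
      · have hc' : Even c₂₄ := (Int.even_mul.1 hc).resolve_left (by decide)
        rw [if_pos hc, if_pos hc', ← pow_add, zero_pow (by omega)]
    · have h3' : IsCoprime 3 (γ 1 0) :=
        (Int.prime_three.irreducible.coprime_iff_not_dvd).2 h3
      have key := tendsto_cuspPart_div hk hαβ h₄ (h₄.three_mul h3') h₈ (h₈.three_mul h3') h₁₆
        (h₁₆.three_mul h3')
      rwa [theta_limit_eq_of_isCoprime hk hαβ hs, sub_self] at key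
      rcases hcase with ⟨hc, he, rfl⟩ | ⟨hc, he, rfl⟩ | ⟨hc, rfl⟩
      · have hv : Odd (c₈ * (e₈ * γ 0 0 + 1)) :=
          hc.mul ((((Int.even_coe_nat _).2 he).mul_right _).add_odd odd_one)
        simp only [if_neg (Int.not_even_iff_odd.2 hc)]
        obtain ⟨j, hj⟩ := he
        rw [show c₈ * ((3 * e₈ : ℕ) * γ 0 0 + 1) + 2 =
          (c₈ * (e₈ * γ 0 0 + 1) + 2) + 4 * (c₈ * j * γ 0 0) by rw [hj]; push_cast; ring,
          I_zpow_add_four_mul, ← pow_add, hαβ, I_zpow_pow_two_mul_of_odd (hv.add_even even_two),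
          pow_add, hsign]
        linear_combination -(-1 : ℂ) ^ k * hsign2
      · have hv : Even (c₈ * (e₈ * γ 0 0 + 1)) := (he.add_odd odd_one).mul_left _
        simp only [if_neg (Int.not_even_iff_odd.2 hc)]
        obtain ⟨j, hj⟩ := hc.mul he
        rw [show c₈ * ((3 * e₈ : ℕ) * γ 0 0 + 1) + 2 =
          (c₈ * (e₈ * γ 0 0 + 1) + 2) + 2 + 4 * j by push_cast; linear_combination 2 * hj,
          I_zpow_add_two, neg_pow _ β, mul_left_comm, ← pow_add, hαβ,
          I_zpow_pow_two_mul_of_even (hv.add even_two), hsign, mul_comm]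
      · simp only [if_pos hc]
        rw [← pow_add, zero_pow (by omega), zero_mul]
  rcases isGcdReduced_cases (γ 1 0) with ⟨e, c₄, c₈, c₁₆, h₄, h₈, h₁₆, hc⟩ |
    ⟨c₄, c₈, c₁₆, h₄, h₈, h₁₆, hc⟩ | ⟨c₄, c₈, c₁₆, h₄, h₈, h₁₆, hc⟩
  · refine ⟨_, _, _, _, _, _, _, h₄, h₈, h₁₆, ?_, .inl ⟨hc, even_two_mul e, rfl⟩⟩
    have he : (e : ℂ) ≠ 0 := by
      obtain ⟨_, _, he, _⟩ := h₄
      exact_mod_cast he.ne'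
    push_cast
    rw [mul_pow, mul_pow, show (4 : ℂ) = 2 * 2 by norm_num, mul_pow]
    field_simp
    ring
  · refine ⟨_, _, _, _, _, _, 1, h₄, h₈, h₁₆, ?_,
      .inr (.inl ⟨hc, by simpa using hodd h₈, rfl⟩)⟩
    simp
  · refine ⟨_, _, _, _, _, _, 0, h₄, h₈, h₁₆, ?_, .inr (.inr ⟨hc, rfl⟩)⟩
    simp

theorem cuspPart_slash {α β k : ℕ} (γ : SL(2, ℤ)) (z : ℍ) :
    ((fun z : ℍ ↦ cuspPart α β k z) ∣[(2 * k : ℤ)] γ) z =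
      cuspPart α β k (γ • z : ℍ) / denom γ z ^ (2 * k) := by
  rw [ModularForm.SL_slash_apply, zpow_neg, div_eq_mul_inv]
  norm_cast

theorem mdifferentiable_cuspPart {α β k : ℕ} (hk : 1 ≤ k) :
    MDiff (fun z : ℍ ↦ cuspPart α β k z) := by
  rw [UpperHalfPlane.mdifferentiable_iff]
  have h (w : ℂ) (hw : 0 < w.im) :
      ((fun z : ℍ ↦ cuspPart α β k z) ∘ ofComplex) w = cuspPart α β k w := by
    rw [Function.comp_apply, ofComplex_apply_of_im_pos hw]
  exact fun z hz ↦ (differentiableAt_cuspPart hk hz).differentiableWithinAt.congr h (h z hz)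

/-- The cusp form `Ψ₈(z)^(2α) Ψ₈(3z)^(2β) - E(z)`, where `E` is the Eisenstein part. -/
noncomputable def cuspPartForm {α β k : ℕ} (hk : 1 ≤ k) (hαβ : α + β = 2 * k) :
    CuspForm (CongruenceSubgroup.Gamma0 48) (2 * k) where
  toFun z := cuspPart α β k z
  slash_action_eq' := by
    rintro _ ⟨γ, hγ, rfl⟩
    have hγ' : 48 ∣ γ 1 0 := by
      rw [SetLike.mem_coe, CongruenceSubgroup.Gamma0_mem] at hγ
      exact_mod_cast (ZMod.intCast_zmod_eq_zero_iff_dvd _ 48).1 hγ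
    ext z
    exact (cuspPart_slash γ z).trans <| by
      rw [cuspPart_smul hk hαβ hγ', mul_div_cancel_left₀]
      exact pow_ne_zero _ (denom_ne_zero _ _)
  holo' := mdifferentiable_cuspPart hk
  zero_at_cusps' {c} hc := by
    rw [Subgroup.IsArithmetic.isCusp_iff_isCusp_SL2Z] at hc
    rw [OnePoint.isZeroAt_iff_forall_SL2Z hc]
    intro γ _
    exact (tendsto_cuspPart_div_zero hk hαβ γ).congr fun z ↦ (cuspPart_slash γ z).symm

end Helpers

theorem stmt_10 (a b k : ℕ) (ha : Even a) (hb : Even b) (hk : 1 ≤ k)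
    (hab : a + b = 4 * k) :
    ∃ C : CuspForm (CongruenceSubgroup.Gamma0 48) (2 * k),
      ∀ z : UpperHalfPlane,
        Psi (8 * (z : ℂ)) ^ a * Psi (24 * (z : ℂ)) ^ b =
          (((-1 : ℂ) ^ ((a + 3 * b) / 4) - 1) /
              (2 ^ (4 * k) * (2 ^ (2 * k) - 1) * (3 ^ (2 * k) - 1))) *
            (((-3 : ℂ) ^ (a / 2) - 1) * E2k k (4 * (z : ℂ)) +
              ((3 : ℂ) ^ (2 * k) - (-3 : ℂ) ^ (a / 2)) * E2k k (12 * (z : ℂ))) +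
          (((2 : ℂ) ^ (2 * k) + 1 - (-1 : ℂ) ^ ((a + 3 * b) / 4)) /
              (2 ^ (4 * k) * (2 ^ (2 * k) - 1) * (3 ^ (2 * k) - 1))) *
            (((-3 : ℂ) ^ (a / 2) - 1) * E2k k (8 * (z : ℂ)) +
              ((3 : ℂ) ^ (2 * k) - (-3 : ℂ) ^ (a / 2)) * E2k k (24 * (z : ℂ))) +
          (-(2 : ℂ) ^ (2 * k) /
              (2 ^ (4 * k) * (2 ^ (2 * k) - 1) * (3 ^ (2 * k) - 1))) *
            (((-3 : ℂ) ^ (a / 2) - 1) * E2k k (16 * (z : ℂ)) +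
              ((3 : ℂ) ^ (2 * k) - (-3 : ℂ) ^ (a / 2)) * E2k k (48 * (z : ℂ))) +
          C z := by
  obtain ⟨α, rfl⟩ := ha
  obtain ⟨β, rfl⟩ := hb
  have hαβ : α + β = 2 * k := by omega
  refine ⟨cuspPartForm hk hαβ, fun z ↦ ?_⟩
  change _ = _ + cuspPart α β k z
  rw [show (α + α + 3 * (β + β)) / 4 = k + β by omega, show (α + α) / 2 = α by omega, cuspPart,
    eisComb, two_mul α, two_mul β]
  ring
end
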